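/- Suppose the limiting system (ODE-Λ) has a solution (Λ₁, Λ₂) on [0, T]. Then there exist N₁ ≥ 1 and a constant C > 0 such that for every N ≥ N₁: (i) with (Λ₁^N, Λ₂^N) the solution of (ODE-Λ^N), the rescaled companion system (ODE-S^N r^N) admits a unique solution (S^N, r^N) on [0,T]; (ii) the vector 𝐒(t) := (S^N(t)ᵀ, …, S^N(t)ᵀ)ᵀ ∈ ℝ^{Nn} (N equal blocks) and the scalar 𝐫(t) := N r^N(t) solve the companion equations (ODE-S) and (ODE-r) associated with the solution 𝐏 of (ODE-P) built from (Λ₁^N, Λ₂^N); and (iii) sup_{t∈[0,T]} (|S^N(t) − S(t)| + |r^N(t) − r(t)|) ≤ C/N, where (S, r) is the unique solution of the limiting companion system (ODE-Sr). -/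

import Mathlib

open Matrix Set

namespace LQ

/-- Frobenius norm of a real matrix. -/
noncomputable def frob {a b : Type*} [Fintype a] [Fintype b] (M : Matrix a b ℝ) : ℝ :=
  Real.sqrt (∑ i, ∑ j, (M i j) ^ 2)

/-- Entrywise ℓ₁ norm of a real matrix. -/
noncomputable def l1norm {a b : Type*} [Fintype a] [Fintype b] (M : Matrix a b ℝ) : ℝ :=
  ∑ i, ∑ j, |M i j|

/-- Block matrix with all diagonal m×m blocks equal to `F` and all off-diagonal blocks equal to `K`. -/
def blockConst (N m : ℕ) (F K : Matrix (Fin m) (Fin m) ℝ) :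
    Matrix (Fin N × Fin m) (Fin N × Fin m) ℝ :=
  Matrix.of fun x y => if x.1 = y.1 then F x.2 y.2 else K x.2 y.2

/-- Block matrix with diagonal blocks `Λ₁` and off-diagonal blocks `Λ₂ / N`. -/
noncomputable def blockPN (N n : ℕ) (Λ₁ Λ₂ : Matrix (Fin n) (Fin n) ℝ) :
    Matrix (Fin N × Fin n) (Fin N × Fin n) ℝ :=
  Matrix.of fun x y => if x.1 = y.1 then Λ₁ x.2 y.2 else Λ₂ x.2 y.2 / (N : ℝ)

/-- The permutation matrix exchanging the i-th and j-th block rows of `I_{Nn}`. -/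
def Jswap (N n : ℕ) (i j : Fin N) : Matrix (Fin N × Fin n) (Fin N × Fin n) ℝ :=
  Matrix.of fun x y => if y.1 = Equiv.swap i j x.1 ∧ y.2 = x.2 then 1 else 0

/-- `I_N ⊗ M`. -/
def kronIN (N : ℕ) {a b : ℕ} (M : Matrix (Fin a) (Fin b) ℝ) :
    Matrix (Fin N × Fin a) (Fin N × Fin b) ℝ :=
  Matrix.of fun x y => if x.1 = y.1 then M x.2 y.2 else 0

/-- `𝟏_{N×1} ⊗ M`. -/
def stackN (N : ℕ) {a b : ℕ} (M : Matrix (Fin a) (Fin b) ℝ) :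
    Matrix (Fin N × Fin a) (Fin b) ℝ :=
  Matrix.of fun x y => M x.2 y

/-- Data of the LQ mean field social optimization problem. -/
structure Params (n n₁ : ℕ) where
  A : Matrix (Fin n) (Fin n) ℝ
  G : Matrix (Fin n) (Fin n) ℝ
  Γ : Matrix (Fin n) (Fin n) ℝ
  Γf : Matrix (Fin n) (Fin n) ℝ
  B : Matrix (Fin n) (Fin n₁) ℝ
  B0 : Matrix (Fin n) (Fin n₁) ℝ
  B1 : Matrix (Fin n) (Fin n₁) ℝ
  D : Matrix (Fin n) (Fin 1) ℝ
  D0 : Matrix (Fin n) (Fin 1) ℝ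
  Q : Matrix (Fin n) (Fin n) ℝ
  Qf : Matrix (Fin n) (Fin n) ℝ
  R : Matrix (Fin n₁) (Fin n₁) ℝ
  T : ℝ

namespace Params

variable {n n₁ : ℕ} (p : Params n n₁)

/-- Standing hypotheses: positive dimensions, positive horizon, symmetric weights. -/
def Standing : Prop :=
  1 ≤ n ∧ 1 ≤ n₁ ∧ 0 < p.T ∧ p.Q.IsSymm ∧ p.Qf.IsSymm ∧ p.R.IsSymm

/-- Q^Γ = Γᵀ Q Γ − Q Γ − Γᵀ Q. -/
def QΓ : Matrix (Fin n) (Fin n) ℝ := p.Γᵀ * p.Q * p.Γ - p.Q * p.Γ - p.Γᵀ * p.Q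

/-- Q_f^Γ = Γ_fᵀ Q_f Γ_f − Q_f Γ_f − Γ_fᵀ Q_f. -/
def QfΓ : Matrix (Fin n) (Fin n) ℝ := p.Γfᵀ * p.Qf * p.Γf - p.Qf * p.Γf - p.Γfᵀ * p.Qf

/-- ℛ₁(Λ₁) = R + B₁ᵀ Λ₁ B₁. -/
def R1 (Λ₁ : Matrix (Fin n) (Fin n) ℝ) : Matrix (Fin n₁) (Fin n₁) ℝ :=
  p.R + p.B1ᵀ * Λ₁ * p.B1

/-- ℛ₂(Λ₁,Λ₂) = R + B₁ᵀ Λ₁ B₁ + B₀ᵀ(Λ₁+Λ₂)B₀. -/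
def R2 (Λ₁ Λ₂ : Matrix (Fin n) (Fin n) ℝ) : Matrix (Fin n₁) (Fin n₁) ℝ :=
  p.R + p.B1ᵀ * Λ₁ * p.B1 + p.B0ᵀ * (Λ₁ + Λ₂) * p.B0

/-- Ψ₁. -/
noncomputable def Ψ₁ (Λ₁ : Matrix (Fin n) (Fin n) ℝ) : Matrix (Fin n) (Fin n) ℝ :=
  Λ₁ * p.B * (p.R1 Λ₁)⁻¹ * p.Bᵀ * Λ₁ - Λ₁ * p.A - p.Aᵀ * Λ₁ - p.Q

/-- Ψ₂. -/
noncomputable def Ψ₂ (Λ₁ Λ₂ : Matrix (Fin n) (Fin n) ℝ) : Matrix (Fin n) (Fin n) ℝ :=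
  (Λ₁ + Λ₂) * p.B * (p.R2 Λ₁ Λ₂)⁻¹ * p.Bᵀ * (Λ₁ + Λ₂)
    - Λ₁ * p.B * (p.R1 Λ₁)⁻¹ * p.Bᵀ * Λ₁
    - (Λ₁ * p.G + Λ₂ * (p.A + p.G))
    - (p.Gᵀ * Λ₁ + (p.Aᵀ + p.Gᵀ) * Λ₂)
    - p.QΓ

/-- Solution of the limiting ODE system (ODE-Λ) on [0,T]. -/
noncomputable def IsSolLim (Λ₁ Λ₂ : ℝ → Matrix (Fin n) (Fin n) ℝ) : Prop :=
  (∀ t ∈ Icc (0 : ℝ) p.T, (Λ₁ t).IsSymm ∧ (Λ₂ t).IsSymm) ∧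
  (∀ t ∈ Icc (0 : ℝ) p.T, (p.R1 (Λ₁ t)).PosDef ∧ (p.R2 (Λ₁ t) (Λ₂ t)).PosDef) ∧
  Λ₁ p.T = p.Qf ∧ Λ₂ p.T = p.QfΓ ∧
  (∀ t ∈ Icc (0 : ℝ) p.T, ∀ i j, HasDerivWithinAt (fun s => Λ₁ s i j)
    (p.Ψ₁ (Λ₁ t) i j) (Icc (0 : ℝ) p.T) t) ∧
  (∀ t ∈ Icc (0 : ℝ) p.T, ∀ i j, HasDerivWithinAt (fun s => Λ₂ s i j)
    (p.Ψ₂ (Λ₁ t) (Λ₂ t) i j) (Icc (0 : ℝ) p.T) t)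

/-! Big (N-agent) matrices. -/

noncomputable def bigA (N : ℕ) : Matrix (Fin N × Fin n) (Fin N × Fin n) ℝ :=
  Matrix.of fun x y => (if x.1 = y.1 then p.A x.2 y.2 else 0) + p.G x.2 y.2 / (N : ℝ)

def bigBhat (N : ℕ) : Matrix (Fin N × Fin n) (Fin N × Fin n₁) ℝ :=
  Matrix.of fun x y => if x.1 = y.1 then p.B x.2 y.2 else 0

def bigB (N : ℕ) (i : Fin N) : Matrix (Fin N × Fin n) (Fin n₁) ℝ :=
  Matrix.of fun x l => if x.1 = i then p.B1 x.2 l else 0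

noncomputable def bigB0 (N : ℕ) : Matrix (Fin N × Fin n) (Fin n₁) ℝ :=
  Matrix.of fun x l => p.B0 x.2 l / (N : ℝ)

def bigD (N : ℕ) (i : Fin N) : Matrix (Fin N × Fin n) (Fin 1) ℝ :=
  Matrix.of fun x l => if x.1 = i then p.D x.2 l else 0

def bigD0 (N : ℕ) : Matrix (Fin N × Fin n) (Fin 1) ℝ :=
  Matrix.of fun x l => p.D0 x.2 l

def bigE (_p : Params n n₁) (N : ℕ) (i : Fin N) : Matrix (Fin n₁) (Fin N × Fin n₁) ℝ :=
  Matrix.of fun k y => if y.1 = i ∧ y.2 = k then 1 else 0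

def bigIhat (_p : Params n n₁) (N : ℕ) : Matrix (Fin n₁) (Fin N × Fin n₁) ℝ :=
  Matrix.of fun k y => if y.2 = k then 1 else 0

noncomputable def bigQ (N : ℕ) : Matrix (Fin N × Fin n) (Fin N × Fin n) ℝ :=
  Matrix.of fun x y => (if x.1 = y.1 then p.Q x.2 y.2 else 0) + p.QΓ x.2 y.2 / (N : ℝ)

noncomputable def bigQf (N : ℕ) : Matrix (Fin N × Fin n) (Fin N × Fin n) ℝ :=
  Matrix.of fun x y => (if x.1 = y.1 then p.Qf x.2 y.2 else 0) + p.QfΓ x.2 y.2 / (N : ℝ)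

def bigR (N : ℕ) : Matrix (Fin N × Fin n₁) (Fin N × Fin n₁) ℝ :=
  Matrix.of fun x y => if x.1 = y.1 then p.R x.2 y.2 else 0

/-- 𝓜₀. -/
noncomputable def M0 (N : ℕ) (Z : Matrix (Fin N × Fin n) (Fin N × Fin n) ℝ) :
    Matrix (Fin 1) (Fin 1) ℝ :=
  (1 / 2 : ℝ) • (∑ i : Fin N, (p.bigD N i)ᵀ * Z * p.bigD N i)
    + (1 / 2 : ℝ) • ((p.bigD0 N)ᵀ * Z * p.bigD0 N)

/-- 𝓜₁. -/
noncomputable def M1 (N : ℕ) (Z : Matrix (Fin N × Fin n) (Fin N × Fin n) ℝ) :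
    Matrix (Fin 1) (Fin N × Fin n₁) ℝ :=
  (∑ i : Fin N, (p.bigD N i)ᵀ * Z * p.bigB N i * p.bigE N i)
    + (p.bigD0 N)ᵀ * Z * p.bigB0 N * p.bigIhat N

/-- 𝓜₂. -/
noncomputable def M2 (N : ℕ) (Z : Matrix (Fin N × Fin n) (Fin N × Fin n) ℝ) :
    Matrix (Fin N × Fin n₁) (Fin N × Fin n₁) ℝ :=
  (1 / 2 : ℝ) • (∑ i : Fin N, (p.bigE N i)ᵀ * (p.bigB N i)ᵀ * Z * p.bigB N i * p.bigE N i)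
    + (1 / 2 : ℝ) • ((p.bigIhat N)ᵀ * (p.bigB0 N)ᵀ * Z * p.bigB0 N * p.bigIhat N)

/-- Right-hand side of the Riccati equation (ODE-P). -/
noncomputable def PRic (N : ℕ) (P : Matrix (Fin N × Fin n) (Fin N × Fin n) ℝ) :
    Matrix (Fin N × Fin n) (Fin N × Fin n) ℝ :=
  P * p.bigBhat N * (p.bigR N + (2 : ℝ) • p.M2 N P)⁻¹ * (p.bigBhat N)ᵀ * P
    - P * p.bigA N - (p.bigA N)ᵀ * P - p.bigQ N

/-- Solution of the large-scale Riccati equation (ODE-P) on [0,T]. -/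
noncomputable def IsSolP (N : ℕ) (P : ℝ → Matrix (Fin N × Fin n) (Fin N × Fin n) ℝ) : Prop :=
  (∀ t ∈ Icc (0 : ℝ) p.T, (P t).IsSymm) ∧
  (∀ t ∈ Icc (0 : ℝ) p.T, (p.bigR N + (2 : ℝ) • p.M2 N (P t)).PosDef) ∧
  P p.T = p.bigQf N ∧
  (∀ t ∈ Icc (0 : ℝ) p.T, ∀ x y, HasDerivWithinAt (fun s => P s x y)
    (p.PRic N (P t) x y) (Icc (0 : ℝ) p.T) t)

/-- Solution of the companion linear equation (ODE-S) on [0,T], relative to `P`. -/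
noncomputable def IsSolS (N : ℕ) (P : ℝ → Matrix (Fin N × Fin n) (Fin N × Fin n) ℝ)
    (S : ℝ → Matrix (Fin N × Fin n) (Fin 1) ℝ) : Prop :=
  S p.T = 0 ∧
  (∀ t ∈ Icc (0 : ℝ) p.T, ∀ x y, HasDerivWithinAt (fun s => S s x y)
    ((P t * p.bigBhat N * (p.bigR N + (2 : ℝ) • p.M2 N (P t))⁻¹ *
        ((p.bigBhat N)ᵀ * S t + (p.M1 N (P t))ᵀ) - (p.bigA N)ᵀ * S t) x y)
    (Icc (0 : ℝ) p.T) t)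

/-- Solution of the companion scalar equation (ODE-r) on [0,T], relative to `P` and `S`. -/
noncomputable def IsSolr (N : ℕ) (P : ℝ → Matrix (Fin N × Fin n) (Fin N × Fin n) ℝ)
    (S : ℝ → Matrix (Fin N × Fin n) (Fin 1) ℝ) (r : ℝ → ℝ) : Prop :=
  r p.T = 0 ∧
  (∀ t ∈ Icc (0 : ℝ) p.T, HasDerivWithinAt r
    (((((S t)ᵀ * p.bigBhat N + p.M1 N (P t)) * (p.bigR N + (2 : ℝ) • p.M2 N (P t))⁻¹ *
        ((p.bigBhat N)ᵀ * S t + (p.M1 N (P t))ᵀ)) - (2 : ℝ) • p.M0 N (P t)) 0 0)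
    (Icc (0 : ℝ) p.T) t)

/-- Asymptotic solvability of the LQ mean field social optimization problem. -/
noncomputable def AsympSolvable : Prop :=
  ∃ N₀ : ℕ, 1 ≤ N₀ ∧ ∃ c₀ : ℝ, 0 < c₀ ∧ ∃ C : ℝ,
    ∀ N : ℕ, N₀ ≤ N →
      ∃ P : ℝ → Matrix (Fin N × Fin n) (Fin N × Fin n) ℝ,
        p.IsSolP N P ∧
        (∀ t ∈ Icc (0 : ℝ) p.T, l1norm (P t) / (N : ℝ) ≤ C) ∧
        (∀ t ∈ Icc (0 : ℝ) p.T,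
          (p.bigR N + (2 : ℝ) • p.M2 N (P t) - c₀ • 1).PosSemidef)

/-! The rescaled low-dimensional system. -/

/-- E^N. -/
noncomputable def EN (N : ℕ) (Λ₁ Λ₂ : Matrix (Fin n) (Fin n) ℝ) :
    Matrix (Fin n₁) (Fin n₁) ℝ :=
  (1 / (N : ℝ)) •
    ((p.R2 Λ₁ Λ₂ - (1 / (N : ℝ)) • (p.B0ᵀ * Λ₂ * p.B0))⁻¹ - (p.R1 Λ₁)⁻¹)

/-- H^N. -/
noncomputable def HN (N : ℕ) (Λ₁ Λ₂ : Matrix (Fin n) (Fin n) ℝ) :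
    Matrix (Fin n₁) (Fin n₁) ℝ :=
  p.EN N Λ₁ Λ₂ + (p.R1 Λ₁)⁻¹

/-- g₁. -/
noncomputable def g₁ (N : ℕ) (Λ₁ Λ₂ : Matrix (Fin n) (Fin n) ℝ) :
    Matrix (Fin n) (Fin n) ℝ :=
  Λ₁ * p.B * p.EN N Λ₁ Λ₂ * p.Bᵀ * Λ₁
  + (1 - 1 / (N : ℝ)) •
      (Λ₂ * p.B * p.EN N Λ₁ Λ₂ * p.Bᵀ * Λ₁ + Λ₁ * p.B * p.EN N Λ₁ Λ₂ * p.Bᵀ * Λ₂)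
  + (1 / (N : ℝ) - 1 / (N : ℝ) ^ 2) •
      (Λ₂ * p.B * (p.HN N Λ₁ Λ₂ + ((N : ℝ) - 2) • p.EN N Λ₁ Λ₂) * p.Bᵀ * Λ₂)
  - (1 / (N : ℝ)) •
      ((Λ₁ * p.G + p.Gᵀ * Λ₁) + (1 - 1 / (N : ℝ)) • (Λ₂ * p.G + p.Gᵀ * Λ₂))
  - (1 / (N : ℝ)) • p.QΓ

/-- g₂. -/
noncomputable def g₂ (N : ℕ) (Λ₁ Λ₂ : Matrix (Fin n) (Fin n) ℝ) :
    Matrix (Fin n) (Fin n) ℝ :=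
  (Λ₁ + Λ₂) * p.B *
      ((N : ℝ) • p.EN N Λ₁ Λ₂ + (p.R1 Λ₁)⁻¹ - (p.R2 Λ₁ Λ₂)⁻¹) * p.Bᵀ * (Λ₁ + Λ₂)
  - (2 / (N : ℝ)) • (Λ₂ * p.B * (p.R1 Λ₁)⁻¹ * p.Bᵀ * Λ₂)
  + (1 / (N : ℝ) - 2) • (Λ₂ * p.B * p.EN N Λ₁ Λ₂ * p.Bᵀ * Λ₂)
  - Λ₁ * p.B * p.EN N Λ₁ Λ₂ * p.Bᵀ * Λ₂
  - Λ₂ * p.B * p.EN N Λ₁ Λ₂ * p.Bᵀ * Λ₁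
  + (1 / (N : ℝ)) • (Λ₂ * p.G + p.Gᵀ * Λ₂)

/-- Solution of the rescaled system (ODE-Λ^N) on [0,T]. -/
noncomputable def IsSolLamN (N : ℕ) (Λ₁ Λ₂ : ℝ → Matrix (Fin n) (Fin n) ℝ) : Prop :=
  (∀ t ∈ Icc (0 : ℝ) p.T, (Λ₁ t).IsSymm ∧ (Λ₂ t).IsSymm) ∧
  (∀ t ∈ Icc (0 : ℝ) p.T, (p.R1 (Λ₁ t)).PosDef ∧ (p.R2 (Λ₁ t) (Λ₂ t)).PosDef ∧
    (p.R2 (Λ₁ t) (Λ₂ t) - (1 / (N : ℝ)) • (p.B0ᵀ * Λ₂ t * p.B0)).PosDef) ∧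
  Λ₁ p.T = p.Qf + (1 / (N : ℝ)) • p.QfΓ ∧ Λ₂ p.T = p.QfΓ ∧
  (∀ t ∈ Icc (0 : ℝ) p.T, ∀ i j, HasDerivWithinAt (fun s => Λ₁ s i j)
    ((p.Ψ₁ (Λ₁ t) + p.g₁ N (Λ₁ t) (Λ₂ t)) i j) (Icc (0 : ℝ) p.T) t) ∧
  (∀ t ∈ Icc (0 : ℝ) p.T, ∀ i j, HasDerivWithinAt (fun s => Λ₂ s i j)
    ((p.Ψ₂ (Λ₁ t) (Λ₂ t) + p.g₂ N (Λ₁ t) (Λ₂ t)) i j) (Icc (0 : ℝ) p.T) t)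

/-! Companion (mean-field) equations. -/

/-- φ₁. -/
noncomputable def φ₁ (Λ₁ Λ₂ : Matrix (Fin n) (Fin n) ℝ) (S : Matrix (Fin n) (Fin 1) ℝ) :
    Matrix (Fin n) (Fin 1) ℝ :=
  (Λ₁ + Λ₂) * p.B * (p.R2 Λ₁ Λ₂)⁻¹ *
      (p.Bᵀ * S + p.B1ᵀ * Λ₁ * p.D + p.B0ᵀ * (Λ₁ + Λ₂) * p.D0)
    - (p.A + p.G)ᵀ * S

/-- φ₂. -/
noncomputable def φ₂ (Λ₁ Λ₂ : Matrix (Fin n) (Fin n) ℝ) (S : Matrix (Fin n) (Fin 1) ℝ) :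
    Matrix (Fin 1) (Fin 1) ℝ :=
  (Sᵀ * p.B + p.Dᵀ * Λ₁ * p.B1 + p.D0ᵀ * (Λ₁ + Λ₂) * p.B0) * (p.R2 Λ₁ Λ₂)⁻¹ *
      (p.Bᵀ * S + p.B1ᵀ * Λ₁ * p.D + p.B0ᵀ * (Λ₁ + Λ₂) * p.D0)
    - p.Dᵀ * Λ₁ * p.D - p.D0ᵀ * (Λ₁ + Λ₂) * p.D0

/-- Solution of the limiting companion system (ODE-Sr) on [0,T]. -/
noncomputable def IsSolSr (Λ₁ Λ₂ : ℝ → Matrix (Fin n) (Fin n) ℝ)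
    (S : ℝ → Matrix (Fin n) (Fin 1) ℝ) (r : ℝ → ℝ) : Prop :=
  S p.T = 0 ∧ r p.T = 0 ∧
  (∀ t ∈ Icc (0 : ℝ) p.T, ∀ i j, HasDerivWithinAt (fun s => S s i j)
    (p.φ₁ (Λ₁ t) (Λ₂ t) (S t) i j) (Icc (0 : ℝ) p.T) t) ∧
  (∀ t ∈ Icc (0 : ℝ) p.T, HasDerivWithinAt r
    ((p.φ₂ (Λ₁ t) (Λ₂ t) (S t)) 0 0) (Icc (0 : ℝ) p.T) t)

/-- g₀₁. -/
noncomputable def g01 (N : ℕ) (Λ₁ Λ₂ : Matrix (Fin n) (Fin n) ℝ)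
    (S : Matrix (Fin n) (Fin 1) ℝ) : Matrix (Fin n) (Fin 1) ℝ :=
  (Λ₁ + (1 - 1 / (N : ℝ)) • Λ₂) * p.B *
      (p.R2 Λ₁ Λ₂ - (1 / (N : ℝ)) • (p.B0ᵀ * Λ₂ * p.B0))⁻¹ *
      (p.Bᵀ * S + p.B1ᵀ * Λ₁ * p.D + p.B0ᵀ * (Λ₁ + (1 - 1 / (N : ℝ)) • Λ₂) * p.D0)
  - (Λ₁ + Λ₂) * p.B * (p.R2 Λ₁ Λ₂)⁻¹ *
      (p.Bᵀ * S + p.B1ᵀ * Λ₁ * p.D + p.B0ᵀ * (Λ₁ + Λ₂) * p.D0)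

/-- g₀₂. -/
noncomputable def g02 (N : ℕ) (Λ₁ Λ₂ : Matrix (Fin n) (Fin n) ℝ)
    (S : Matrix (Fin n) (Fin 1) ℝ) : Matrix (Fin 1) (Fin 1) ℝ :=
  (Sᵀ * p.B + p.Dᵀ * Λ₁ * p.B1 + p.D0ᵀ * (Λ₁ + (1 - 1 / (N : ℝ)) • Λ₂) * p.B0) *
      (p.R2 Λ₁ Λ₂ - (1 / (N : ℝ)) • (p.B0ᵀ * Λ₂ * p.B0))⁻¹ *
      (p.Bᵀ * S + p.B1ᵀ * Λ₁ * p.D + p.B0ᵀ * (Λ₁ + (1 - 1 / (N : ℝ)) • Λ₂) * p.D0)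
  - (Sᵀ * p.B + p.Dᵀ * Λ₁ * p.B1 + p.D0ᵀ * (Λ₁ + Λ₂) * p.B0) * (p.R2 Λ₁ Λ₂)⁻¹ *
      (p.Bᵀ * S + p.B1ᵀ * Λ₁ * p.D + p.B0ᵀ * (Λ₁ + Λ₂) * p.D0)
  + (1 / (N : ℝ)) • (p.D0ᵀ * Λ₂ * p.D0)

/-- Solution of the rescaled companion system (ODE-S^N r^N) on [0,T]. -/
noncomputable def IsSolSrN (N : ℕ) (Λ₁ Λ₂ : ℝ → Matrix (Fin n) (Fin n) ℝ)
    (S : ℝ → Matrix (Fin n) (Fin 1) ℝ) (r : ℝ → ℝ) : Prop :=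
  S p.T = 0 ∧ r p.T = 0 ∧
  (∀ t ∈ Icc (0 : ℝ) p.T, ∀ i j, HasDerivWithinAt (fun s => S s i j)
    ((p.φ₁ (Λ₁ t) (Λ₂ t) (S t) + p.g01 N (Λ₁ t) (Λ₂ t) (S t)) i j) (Icc (0 : ℝ) p.T) t) ∧
  (∀ t ∈ Icc (0 : ℝ) p.T, HasDerivWithinAt r
    ((p.φ₂ (Λ₁ t) (Λ₂ t) (S t) + p.g02 N (Λ₁ t) (Λ₂ t) (S t)) 0 0) (Icc (0 : ℝ) p.T) t)

/-! Feedback gains. -/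

/-- Θ = ℛ₁(Λ₁)⁻¹ Bᵀ Λ₁. -/
noncomputable def Theta (Λ₁ : Matrix (Fin n) (Fin n) ℝ) : Matrix (Fin n₁) (Fin n) ℝ :=
  (p.R1 Λ₁)⁻¹ * p.Bᵀ * Λ₁

/-- Θ₁ = (H₁ − H)Bᵀ(Λ₁+Λ₂) + HBᵀΛ₂. -/
noncomputable def Theta1 (Λ₁ Λ₂ : Matrix (Fin n) (Fin n) ℝ) : Matrix (Fin n₁) (Fin n) ℝ :=
  ((p.R2 Λ₁ Λ₂)⁻¹ - (p.R1 Λ₁)⁻¹) * p.Bᵀ * (Λ₁ + Λ₂) + (p.R1 Λ₁)⁻¹ * p.Bᵀ * Λ₂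

/-- Θ₂ = H₁[BᵀS + B₁ᵀΛ₁D + B₀ᵀ(Λ₁+Λ₂)D₀]. -/
noncomputable def Theta2 (Λ₁ Λ₂ : Matrix (Fin n) (Fin n) ℝ) (S : Matrix (Fin n) (Fin 1) ℝ) :
    Matrix (Fin n₁) (Fin 1) ℝ :=
  (p.R2 Λ₁ Λ₂)⁻¹ * (p.Bᵀ * S + p.B1ᵀ * Λ₁ * p.D + p.B0ᵀ * (Λ₁ + Λ₂) * p.D0)

/-- Θ^N. -/
noncomputable def ThetaN (N : ℕ) (Λ₁ Λ₂ : Matrix (Fin n) (Fin n) ℝ) :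
    Matrix (Fin n₁) (Fin n) ℝ :=
  (p.HN N Λ₁ Λ₂ - p.EN N Λ₁ Λ₂) * p.Bᵀ * (Λ₁ - (1 / (N : ℝ)) • Λ₂)

/-- Θ₁^N. -/
noncomputable def Theta1N (N : ℕ) (Λ₁ Λ₂ : Matrix (Fin n) (Fin n) ℝ) :
    Matrix (Fin n₁) (Fin n) ℝ :=
  (N : ℝ) • (p.EN N Λ₁ Λ₂ * p.Bᵀ * Λ₁)
    + (p.HN N Λ₁ Λ₂ + ((N : ℝ) - 2) • p.EN N Λ₁ Λ₂) * p.Bᵀ * Λ₂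

/-- Θ₂^N. -/
noncomputable def Theta2N (N : ℕ) (Λ₁ Λ₂ : Matrix (Fin n) (Fin n) ℝ)
    (S : Matrix (Fin n) (Fin 1) ℝ) : Matrix (Fin n₁) (Fin 1) ℝ :=
  (p.HN N Λ₁ Λ₂ + ((N : ℝ) - 1) • p.EN N Λ₁ Λ₂) *
    (p.Bᵀ * S + p.B1ᵀ * Λ₁ * p.D + p.B0ᵀ * (Λ₁ + (1 - 1 / (N : ℝ)) • Λ₂) * p.D0)

/-- Z₀ = −B₀(Θ + Θ₁). -/
noncomputable def Z0 (Λ₁ Λ₂ : Matrix (Fin n) (Fin n) ℝ) : Matrix (Fin n) (Fin n) ℝ :=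
  -(p.B0 * (p.Theta Λ₁ + p.Theta1 Λ₁ Λ₂))

/-- Z₁ = A + G − B(Θ + Θ₁). -/
noncomputable def Z1 (Λ₁ Λ₂ : Matrix (Fin n) (Fin n) ℝ) : Matrix (Fin n) (Fin n) ℝ :=
  p.A + p.G - p.B * (p.Theta Λ₁ + p.Theta1 Λ₁ Λ₂)

/-! The high-dimensional equations under the decentralized control. -/

/-- RHS of (ODE-P̌₁) (paper's −d𝐏̌₁/dt). -/
noncomputable def Pcheck1RHS (N : ℕ) (Θ : Matrix (Fin n₁) (Fin n) ℝ)
    (P1 : Matrix (Fin N × Fin n) (Fin N × Fin n) ℝ) :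
    Matrix (Fin N × Fin n) (Fin N × Fin n) ℝ :=
  (kronIN N Θ)ᵀ * (p.bigR N + p.M2 N ((2 : ℝ) • P1)) * kronIN N Θ
    + P1 * (p.bigA N - p.bigBhat N * kronIN N Θ)
    + (p.bigA N - p.bigBhat N * kronIN N Θ)ᵀ * P1
    + p.bigQ N

/-- Solution of (ODE-P̌₁) on [0,T], with Θ(t) built from Λ₁(t). -/
noncomputable def IsSolPcheck1 (N : ℕ) (Λ₁ : ℝ → Matrix (Fin n) (Fin n) ℝ)
    (P1 : ℝ → Matrix (Fin N × Fin n) (Fin N × Fin n) ℝ) : Prop :=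
  P1 p.T = p.bigQf N ∧
  (∀ t ∈ Icc (0 : ℝ) p.T, ∀ x y, HasDerivWithinAt (fun s => P1 s x y)
    ((-(p.Pcheck1RHS N (p.Theta (Λ₁ t)) (P1 t))) x y) (Icc (0 : ℝ) p.T) t)

/-- RHS of (ODE-P̌₁₂) (paper's −d𝐏̌₁₂/dt). -/
noncomputable def Pcheck12RHS (N : ℕ) (Λ₁m Λ₂m : Matrix (Fin n) (Fin n) ℝ)
    (P1 : Matrix (Fin N × Fin n) (Fin N × Fin n) ℝ)
    (P12 : Matrix (Fin N × Fin n) (Fin n) ℝ) :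
    Matrix (Fin N × Fin n) (Fin n) ℝ :=
  (kronIN N (p.Theta Λ₁m))ᵀ * (p.bigR N + p.M2 N ((2 : ℝ) • P1)) *
      stackN N (p.Theta1 Λ₁m Λ₂m)
    - P1 * p.bigBhat N * stackN N (p.Theta1 Λ₁m Λ₂m)
    + ((p.bigA N)ᵀ - (kronIN N (p.Theta Λ₁m))ᵀ * (p.bigBhat N)ᵀ) * P12
    + P12 * p.Z1 Λ₁m Λ₂m
    - (kronIN N (p.Theta Λ₁m))ᵀ * (p.bigIhat N)ᵀ * (p.bigB0 N)ᵀ * P12 * p.Z0 Λ₁m Λ₂m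

/-- Solution of (ODE-P̌₁₂) on [0,T]. -/
noncomputable def IsSolPcheck12 (N : ℕ) (Λ₁ Λ₂ : ℝ → Matrix (Fin n) (Fin n) ℝ)
    (P1 : ℝ → Matrix (Fin N × Fin n) (Fin N × Fin n) ℝ)
    (P12 : ℝ → Matrix (Fin N × Fin n) (Fin n) ℝ) : Prop :=
  P12 p.T = 0 ∧
  (∀ t ∈ Icc (0 : ℝ) p.T, ∀ x y, HasDerivWithinAt (fun s => P12 s x y)
    ((-(p.Pcheck12RHS N (Λ₁ t) (Λ₂ t) (P1 t) (P12 t))) x y) (Icc (0 : ℝ) p.T) t)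

/-! The decentralized-control low-dimensional coefficient system. -/

/-- ǧ₁. -/
noncomputable def gc1 (N : ℕ) (Θ : Matrix (Fin n₁) (Fin n) ℝ)
    (L1 L2 : Matrix (Fin n) (Fin n) ℝ) : Matrix (Fin n) (Fin n) ℝ :=
  (1 / (N : ℝ)) •
    (Θᵀ * p.B0ᵀ * (L1 + (1 - 1 / (N : ℝ)) • L2) * p.B0 * Θ
      + (L1 + (1 - 1 / (N : ℝ)) • L2) * p.G
      + p.Gᵀ * (L1 + (1 - 1 / (N : ℝ)) • L2)
      + p.QΓ)

/-- ǧ₂. -/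
noncomputable def gc2 (N : ℕ) (Θ : Matrix (Fin n₁) (Fin n) ℝ)
    (L2 : Matrix (Fin n) (Fin n) ℝ) : Matrix (Fin n) (Fin n) ℝ :=
  -((1 / (N : ℝ)) • (Θᵀ * p.B0ᵀ * L2 * p.B0 * Θ + L2 * p.G + p.Gᵀ * L2))

/-- ǧ₁₂. -/
noncomputable def gc12 (N : ℕ) (Θ Θ₁ : Matrix (Fin n₁) (Fin n) ℝ)
    (L2 : Matrix (Fin n) (Fin n) ℝ) : Matrix (Fin n) (Fin n) ℝ :=
  (1 / (N : ℝ)) • (-(Θᵀ * p.B0ᵀ * L2 * p.B0 * Θ₁) + L2 * p.B * Θ₁)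

/-- ǧ₂₂. -/
noncomputable def gc22 (N : ℕ) (Θ₁ : Matrix (Fin n₁) (Fin n) ℝ)
    (L2 : Matrix (Fin n) (Fin n) ℝ) : Matrix (Fin n) (Fin n) ℝ :=
  -((1 / (N : ℝ)) • (Θ₁ᵀ * p.B0ᵀ * L2 * p.B0 * Θ₁))

/-- ǧ₀₁. -/
noncomputable def gc01 (N : ℕ) (Θ : Matrix (Fin n₁) (Fin n) ℝ)
    (Θ₂ : Matrix (Fin n₁) (Fin 1) ℝ) (L2 : Matrix (Fin n) (Fin n) ℝ) :
    Matrix (Fin n) (Fin 1) ℝ :=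
  (1 / (N : ℝ)) • (Θᵀ * p.B0ᵀ * L2 * (p.D0 - p.B0 * Θ₂) + L2 * p.B * Θ₂)

/-- ǧ₀₂. -/
noncomputable def gc02 (N : ℕ) (Θ₁ : Matrix (Fin n₁) (Fin n) ℝ)
    (Θ₂ : Matrix (Fin n₁) (Fin 1) ℝ) (L2 : Matrix (Fin n) (Fin n) ℝ) :
    Matrix (Fin n) (Fin 1) ℝ :=
  (1 / (N : ℝ)) • (-(Θ₁ᵀ * p.B0ᵀ * L2 * p.B0 * Θ₂) + Θ₁ᵀ * p.B0ᵀ * L2 * p.D0)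

/-- RHS of (ODE-Λ̌₁^N) (paper's −dΛ̌₁^N/dt). -/
noncomputable def check1RHS (N : ℕ) (Θ : Matrix (Fin n₁) (Fin n) ℝ)
    (L1 L2 : Matrix (Fin n) (Fin n) ℝ) : Matrix (Fin n) (Fin n) ℝ :=
  Θᵀ * p.R1 L1 * Θ + L1 * (p.A - p.B * Θ) + (p.A - p.B * Θ)ᵀ * L1 + p.Q
    + p.gc1 N Θ L1 L2

/-- RHS of (ODE-Λ̌₂^N). -/
noncomputable def check2RHS (N : ℕ) (Θ : Matrix (Fin n₁) (Fin n) ℝ)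
    (L1 L2 : Matrix (Fin n) (Fin n) ℝ) : Matrix (Fin n) (Fin n) ℝ :=
  Θᵀ * p.B0ᵀ * (L1 + L2) * p.B0 * Θ + L1 * p.G + p.Gᵀ * L1
    + L2 * (p.A + p.G - p.B * Θ) + (p.A + p.G - p.B * Θ)ᵀ * L2 + p.QΓ
    + p.gc2 N Θ L2

/-- RHS of (ODE-Λ̌₁₂^N). -/
noncomputable def check12RHS (N : ℕ) (Θ Θ₁ : Matrix (Fin n₁) (Fin n) ℝ)
    (L1 L2 L12 : Matrix (Fin n) (Fin n) ℝ) : Matrix (Fin n) (Fin n) ℝ :=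
  Θᵀ * p.R2 L1 L2 * Θ₁ + Θᵀ * p.B0ᵀ * L12 * p.B0 * (Θ + Θ₁)
    - (L1 + L2) * p.B * Θ₁
    + (p.A + p.G - p.B * Θ)ᵀ * L12
    + L12 * (p.A + p.G - p.B * (Θ₁ + Θ))
    + p.gc12 N Θ Θ₁ L2

/-- RHS of (ODE-Λ̌₂₂^N). -/
noncomputable def check22RHS (N : ℕ) (Θ₁ : Matrix (Fin n₁) (Fin n) ℝ)
    (Z₀ Z₁ : Matrix (Fin n) (Fin n) ℝ)
    (L1 L2 L12 L22 : Matrix (Fin n) (Fin n) ℝ) : Matrix (Fin n) (Fin n) ℝ :=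
  Θ₁ᵀ * p.R2 L1 L2 * Θ₁ - L12ᵀ * p.B * Θ₁ - Θ₁ᵀ * p.Bᵀ * L12
    + L22 * Z₁ + Z₁ᵀ * L22
    - Z₀ᵀ * L12ᵀ * p.B0 * Θ₁ - Θ₁ᵀ * p.B0ᵀ * L12 * Z₀
    + Z₀ᵀ * L22 * Z₀ + p.gc22 N Θ₁ L2

/-- RHS of (ODE-Š₁^N). -/
noncomputable def checkS1RHS (N : ℕ) (Θ : Matrix (Fin n₁) (Fin n) ℝ)
    (Θ₂ : Matrix (Fin n₁) (Fin 1) ℝ) (L1 L2 L12 : Matrix (Fin n) (Fin n) ℝ)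
    (S1 : Matrix (Fin n) (Fin 1) ℝ) : Matrix (Fin n) (Fin 1) ℝ :=
  Θᵀ * p.R2 L1 L2 * Θ₂ - (L1 + L2 + L12) * p.B * Θ₂
    - Θᵀ * (p.Bᵀ * S1 + p.B1ᵀ * L1 * p.D + p.B0ᵀ * (L1 + L2) * p.D0)
    - Θᵀ * p.B0ᵀ * L12 * (p.D0 - p.B0 * Θ₂)
    + (p.A + p.G)ᵀ * S1
    + p.gc01 N Θ Θ₂ L2

/-- RHS of (ODE-Š₂^N). -/
noncomputable def checkS2RHS (N : ℕ) (Θ₁ : Matrix (Fin n₁) (Fin n) ℝ)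
    (Θ₂ : Matrix (Fin n₁) (Fin 1) ℝ) (Z₀ Z₁ : Matrix (Fin n) (Fin n) ℝ)
    (L1 L2 L12 L22 : Matrix (Fin n) (Fin n) ℝ)
    (S1 S2 : Matrix (Fin n) (Fin 1) ℝ) : Matrix (Fin n) (Fin 1) ℝ :=
  Θ₁ᵀ * p.R2 L1 L2 * Θ₂ + Z₁ᵀ * S2
    - Θ₁ᵀ * (p.Bᵀ * S1 + p.B1ᵀ * L1 * p.D + p.B0ᵀ * (L1 + L2) * p.D0)
    + (Z₀ᵀ * L22 + Z₀ᵀ * L12ᵀ - Θ₁ᵀ * p.B0ᵀ * L12) * (p.D0 - p.B0 * Θ₂)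
    - (L12ᵀ + L22) * p.B * Θ₂
    + p.gc02 N Θ₁ Θ₂ L2

/-- Solution of the pair (ODE-Λ̌₁^N)–(ODE-Λ̌₂^N) on [0,T], with Θ(t) from the limiting Λ₁. -/
noncomputable def IsSolCheckA (N : ℕ) (Λ₁ : ℝ → Matrix (Fin n) (Fin n) ℝ)
    (L1 L2 : ℝ → Matrix (Fin n) (Fin n) ℝ) : Prop :=
  L1 p.T = p.Qf + (1 / (N : ℝ)) • p.QfΓ ∧ L2 p.T = p.QfΓ ∧
  (∀ t ∈ Icc (0 : ℝ) p.T, ∀ i j, HasDerivWithinAt (fun s => L1 s i j)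
    ((-(p.check1RHS N (p.Theta (Λ₁ t)) (L1 t) (L2 t))) i j) (Icc (0 : ℝ) p.T) t) ∧
  (∀ t ∈ Icc (0 : ℝ) p.T, ∀ i j, HasDerivWithinAt (fun s => L2 s i j)
    ((-(p.check2RHS N (p.Theta (Λ₁ t)) (L1 t) (L2 t))) i j) (Icc (0 : ℝ) p.T) t)

/-- Solution of (ODE-Λ̌₁^N)–(ODE-Λ̌₂₂^N) on [0,T], with Θ, Θ₁, Z₀, Z₁ from the limiting (Λ₁, Λ₂). -/
noncomputable def IsSolCheckB (N : ℕ) (Λ₁ Λ₂ : ℝ → Matrix (Fin n) (Fin n) ℝ)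
    (L1 L2 L12 L22 : ℝ → Matrix (Fin n) (Fin n) ℝ) : Prop :=
  p.IsSolCheckA N Λ₁ L1 L2 ∧
  L12 p.T = 0 ∧ L22 p.T = 0 ∧
  (∀ t ∈ Icc (0 : ℝ) p.T, ∀ i j, HasDerivWithinAt (fun s => L12 s i j)
    ((-(p.check12RHS N (p.Theta (Λ₁ t)) (p.Theta1 (Λ₁ t) (Λ₂ t))
        (L1 t) (L2 t) (L12 t))) i j) (Icc (0 : ℝ) p.T) t) ∧
  (∀ t ∈ Icc (0 : ℝ) p.T, ∀ i j, HasDerivWithinAt (fun s => L22 s i j)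
    ((-(p.check22RHS N (p.Theta1 (Λ₁ t) (Λ₂ t)) (p.Z0 (Λ₁ t) (Λ₂ t))
        (p.Z1 (Λ₁ t) (Λ₂ t)) (L1 t) (L2 t) (L12 t) (L22 t))) i j) (Icc (0 : ℝ) p.T) t)

/-- Solution of the full decentralized coefficient system on [0,T],
with Θ, Θ₁, Θ₂, Z₀, Z₁ from the limiting (Λ₁, Λ₂, S). -/
noncomputable def IsSolCheckC (N : ℕ) (Λ₁ Λ₂ : ℝ → Matrix (Fin n) (Fin n) ℝ)
    (S : ℝ → Matrix (Fin n) (Fin 1) ℝ)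
    (L1 L2 L12 L22 : ℝ → Matrix (Fin n) (Fin n) ℝ)
    (S1 S2 : ℝ → Matrix (Fin n) (Fin 1) ℝ) : Prop :=
  p.IsSolCheckB N Λ₁ Λ₂ L1 L2 L12 L22 ∧
  S1 p.T = 0 ∧ S2 p.T = 0 ∧
  (∀ t ∈ Icc (0 : ℝ) p.T, ∀ i j, HasDerivWithinAt (fun s => S1 s i j)
    ((-(p.checkS1RHS N (p.Theta (Λ₁ t)) (p.Theta2 (Λ₁ t) (Λ₂ t) (S t))
        (L1 t) (L2 t) (L12 t) (S1 t))) i j) (Icc (0 : ℝ) p.T) t) ∧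
  (∀ t ∈ Icc (0 : ℝ) p.T, ∀ i j, HasDerivWithinAt (fun s => S2 s i j)
    ((-(p.checkS2RHS N (p.Theta1 (Λ₁ t) (Λ₂ t)) (p.Theta2 (Λ₁ t) (Λ₂ t) (S t))
        (p.Z0 (Λ₁ t) (Λ₂ t)) (p.Z1 (Λ₁ t) (Λ₂ t))
        (L1 t) (L2 t) (L12 t) (L22 t) (S1 t) (S2 t))) i j) (Icc (0 : ℝ) p.T) t)

end Params

/-- A `C¹` vector field is uniformly Lipschitz around the points of a compact set. -/
lemma exists_lipschitz_near_compact {E : Type*} [NormedAddCommGroup E] [NormedSpace ℝ E]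
    {v : E → E} {K : Set E} (hK : IsCompact K) (hv : ∀ x ∈ K, ContDiffAt ℝ 1 v x) :
    ∃ L δ : ℝ, 0 ≤ L ∧ 0 < δ ∧ ∀ x ∈ K, ∀ y, ‖y - x‖ < δ → ‖v y - v x‖ ≤ L * ‖y - x‖ := by
  refine hK.induction_on (p := fun s => ∃ L δ : ℝ, 0 ≤ L ∧ 0 < δ ∧
    ∀ x ∈ s, ∀ y, ‖y - x‖ < δ → ‖v y - v x‖ ≤ L * ‖y - x‖) ?_ ?_ ?_ ?_
  · exact ⟨0, 1, le_rfl, one_pos, by simp⟩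
  · rintro s t hst ⟨L, δ, hL, hδ, h⟩
    exact ⟨L, δ, hL, hδ, fun x hx => h x (hst hx)⟩
  · rintro s t ⟨L, δ, hL, hδ, h⟩ ⟨L', δ', hL', hδ', h'⟩
    refine ⟨max L L', min δ δ', le_max_of_le_left hL, lt_min hδ hδ', ?_⟩
    rintro x (hx | hx) y hy
    · exact (h x hx y (hy.trans_le (min_le_left _ _))).trans
        (mul_le_mul_of_nonneg_right (le_max_left _ _) (norm_nonneg _))
    · exact (h' x hx y (hy.trans_le (min_le_right _ _))).trans
        (mul_le_mul_of_nonneg_right (le_max_right _ _) (norm_nonneg _))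
  · intro x hx
    obtain ⟨L, t, ht, hL⟩ := (hv x hx).exists_lipschitzOnWith
    obtain ⟨δ, hδ, hball⟩ := Metric.mem_nhds_iff.1 ht
    refine ⟨Metric.ball x (δ / 2), mem_nhdsWithin_of_mem_nhds (Metric.ball_mem_nhds _ (half_pos hδ)),
      L, δ / 2, L.2, half_pos hδ, fun z hz y hy => ?_⟩
    have hzt : z ∈ t := hball (Metric.ball_subset_ball (by linarith) hz)
    have hy' : y ∈ t := hball (by
      rw [Metric.mem_ball] at hz ⊢
      rw [← dist_eq_norm] at hy
      linarith [dist_triangle y z x])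
    simpa [dist_eq_norm] using hL.dist_le_mul y hy' z hzt

/-- Time reversal on a compact interval. -/
lemma hasDerivWithinAt_reverse_Icc {E : Type*} [NormedAddCommGroup E] [NormedSpace ℝ E]
    {f : ℝ → E} {d : E} {T s : ℝ} (h : HasDerivWithinAt f d (Icc 0 T) (T - s)) :
    HasDerivWithinAt (fun s => f (T - s)) (-d) (Icc 0 T) s := by
  have h1 : HasDerivWithinAt (fun s : ℝ => T - s) (-1) (Icc 0 T) s :=
    ((hasDerivAt_id s).const_sub T).hasDerivWithinAt
  have h2 := HasDerivWithinAt.scomp s h h1 (fun x hx => by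
    simp only [mem_Icc] at hx ⊢; constructor <;> linarith)
  simpa [Function.comp_def] using h2

lemma sub_mem_Icc_zero {T s : ℝ} (hs : s ∈ Icc 0 T) : T - s ∈ Icc 0 T := by
  simp only [mem_Icc] at hs ⊢; constructor <;> linarith

lemma hasDerivWithinAt_Ici_of_Icc {E : Type*} [NormedAddCommGroup E] [NormedSpace ℝ E]
    {f : ℝ → E} {d : E} {a b t : ℝ} (h : HasDerivWithinAt f d (Icc a b) t) (ht : t ∈ Ico a b) :
    HasDerivWithinAt f d (Ici t) t :=
  h.mono_of_mem_nhdsWithin (Icc_mem_nhdsGE_of_mem ht)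

/-- Forward stability of a trajectory with respect to its initial value. -/
lemma exists_stability_forward {E : Type*} [NormedAddCommGroup E] [NormedSpace ℝ E]
    {v : E → E} {T : ℝ} {z : ℝ → E}
    (hz : ∀ t ∈ Icc 0 T, HasDerivWithinAt z (v (z t)) (Icc 0 T) t)
    (hv : ∀ t ∈ Icc 0 T, ContDiffAt ℝ 1 v (z t)) :
    ∃ C δ : ℝ, 0 < C ∧ 0 < δ ∧ ∀ (w : ℝ → E) (η : ℝ),
      (∀ t ∈ Icc 0 T, HasDerivWithinAt w (v (w t)) (Icc 0 T) t) → 0 < η → η < δ →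
      ‖w 0 - z 0‖ ≤ η → ∀ t ∈ Icc 0 T, ‖w t - z t‖ ≤ C * η := by
  have hzc : ContinuousOn z (Icc 0 T) := fun t ht => (hz t ht).continuousWithinAt
  obtain ⟨L, δ, hL, hδ, hlip⟩ := exists_lipschitz_near_compact (v := v)
    (isCompact_Icc.image_of_continuousOn hzc) (by rintro _ ⟨t, ht, rfl⟩; exact hv t ht)
  refine ⟨Real.exp ((L + 1) * T), δ / Real.exp ((L + 1) * T), Real.exp_pos _, by positivity, ?_⟩
  intro w η hw hη hηδ h0
  have hwc : ContinuousOn w (Icc 0 T) := fun t ht => (hw t ht).continuousWithinAt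
  have hB : ∀ x : ℝ, HasDerivAt (fun s => η * Real.exp ((L + 1) * s))
      ((L + 1) * (η * Real.exp ((L + 1) * x))) x := by
    intro x
    have := (((hasDerivAt_id x).const_mul (L + 1)).exp).const_mul η
    refine this.congr_deriv ?_
    simp only [id]; ring
  have hmono : ∀ t ∈ Icc 0 T, η * Real.exp ((L + 1) * t) ≤ Real.exp ((L + 1) * T) * η := by
    intro t ht
    rw [mul_comm]
    gcongr
    exact ht.2
  have key := image_norm_le_of_norm_deriv_right_lt_deriv_boundary (a := 0) (b := T)
    (f := fun t => w t - z t) (f' := fun t => v (w t) - v (z t)) (hwc.sub hzc)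
    (fun t ht => hasDerivWithinAt_Ici_of_Icc
      ((hw t (Ico_subset_Icc_self ht)).sub (hz t (Ico_subset_Icc_self ht))) ht)
    (by simpa using h0) hB (by
      intro t ht heq
      have ht' := Ico_subset_Icc_self ht
      have hlt : ‖w t - z t‖ < δ := by
        rw [heq]
        refine (hmono t ht').trans_lt ?_
        rw [lt_div_iff₀ (Real.exp_pos _)] at hηδ
        linarith
      have h1 := hlip _ ⟨t, ht', rfl⟩ _ hlt
      rw [heq] at h1
      have : 0 < η * Real.exp ((L + 1) * t) := by positivity
      linarith)
  exact fun t ht => (key ht).trans (hmono t ht)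

/-- Backward stability of a trajectory with respect to its terminal value. -/
lemma exists_stability_backward {E : Type*} [NormedAddCommGroup E] [NormedSpace ℝ E]
    {v : E → E} {T : ℝ} {z : ℝ → E}
    (hz : ∀ t ∈ Icc 0 T, HasDerivWithinAt z (v (z t)) (Icc 0 T) t)
    (hv : ∀ t ∈ Icc 0 T, ContDiffAt ℝ 1 v (z t)) :
    ∃ C δ : ℝ, 0 < C ∧ 0 < δ ∧ ∀ (w : ℝ → E) (η : ℝ),
      (∀ t ∈ Icc 0 T, HasDerivWithinAt w (v (w t)) (Icc 0 T) t) → 0 < η → η < δ →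
      ‖w T - z T‖ ≤ η → ∀ t ∈ Icc 0 T, ‖w t - z t‖ ≤ C * η := by
  obtain ⟨C, δ, hC, hδ, h⟩ := exists_stability_forward (v := fun x => - v x)
    (z := fun s => z (T - s)) (T := T)
    (fun t ht => hasDerivWithinAt_reverse_Icc (hz _ (sub_mem_Icc_zero ht)))
    (fun t ht => (hv _ (sub_mem_Icc_zero ht)).neg)
  refine ⟨C, δ, hC, hδ, fun w η hw hη hηδ hT t ht => ?_⟩
  have := h (fun s => w (T - s)) η (fun t ht => hasDerivWithinAt_reverse_Icc (hw _ (sub_mem_Icc_zero ht)))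
    hη hηδ (by simpa using hT) (T - t) (sub_mem_Icc_zero ht)
  simpa using this

/-- Uniqueness for the terminal value problem along a trajectory where the field is `C¹`. -/
lemma terminal_value_unique {E : Type*} [NormedAddCommGroup E] [NormedSpace ℝ E]
    {v : E → E} {T : ℝ} {z w : ℝ → E}
    (hz : ∀ t ∈ Icc 0 T, HasDerivWithinAt z (v (z t)) (Icc 0 T) t)
    (hv : ∀ t ∈ Icc 0 T, ContDiffAt ℝ 1 v (z t))
    (hw : ∀ t ∈ Icc 0 T, HasDerivWithinAt w (v (w t)) (Icc 0 T) t) (hT : w T = z T) :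
    ∀ t ∈ Icc 0 T, w t = z t := by
  obtain ⟨C, δ, hC, hδ, h⟩ := exists_stability_backward hz hv
  intro t ht
  rw [← sub_eq_zero, ← norm_le_zero_iff]
  refine le_of_forall_pos_le_add fun e he => ?_
  have hη : 0 < min (δ / 2) (e / C) := by positivity
  refine (h w _ hw hη ((min_le_left _ _).trans_lt (half_lt_self hδ)) (by simp [hT, hη.le])
    t ht).trans ?_
  calc C * min (δ / 2) (e / C) ≤ C * (e / C) := by gcongr; exact min_le_right _ _
    _ = 0 + e := by field_simp; ring

/-- Coordinatewise truncation at level `ρ`. -/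
noncomputable def clampFun {m : ℕ} (ρ : ℝ) (x : Fin m → ℝ) : Fin m → ℝ :=
  fun i => max (-ρ) (min ρ (x i))

lemma clampFun_eq_self {m : ℕ} {ρ : ℝ} {x : Fin m → ℝ} (h : ‖x‖ ≤ ρ) : clampFun ρ x = x := by
  funext i
  have h1 := abs_le.1 ((norm_le_pi_norm x i).trans h)
  simp [clampFun, h1.1, h1.2]

lemma norm_clampFun_sub_le {m : ℕ} (ρ : ℝ) (x y : Fin m → ℝ) :
    ‖clampFun ρ x - clampFun ρ y‖ ≤ ‖x - y‖ := by
  refine (pi_norm_le_iff_of_nonneg (norm_nonneg _)).2 fun i => ?_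
  refine le_trans ?_ (norm_le_pi_norm (x - y) i)
  simp only [clampFun, Pi.sub_apply, Real.norm_eq_abs]
  exact (abs_max_sub_max_le_max (-ρ) _ (-ρ) _).trans (max_le (by simp)
    ((abs_min_sub_min_le_max ρ (x i) ρ (y i)).trans (by simp)))

lemma norm_clampFun_le {m : ℕ} {ρ : ℝ} (hρ : 0 ≤ ρ) (x : Fin m → ℝ) : ‖clampFun ρ x‖ ≤ ‖x‖ := by
  have h := norm_clampFun_sub_le ρ x 0
  rwa [clampFun_eq_self (x := 0) (by simpa using hρ), sub_zero, sub_zero] at h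

lemma norm_clampFun_le_level {m : ℕ} {ρ : ℝ} (hρ : 0 ≤ ρ) (x : Fin m → ℝ) :
    ‖clampFun ρ x‖ ≤ ρ := by
  refine (pi_norm_le_iff_of_nonneg hρ).2 fun i => abs_le.2 ⟨le_max_left _ _, ?_⟩
  exact max_le (by linarith) (min_le_left _ _)

lemma norm_mulVec_le_sum_abs {m : ℕ} (M : Matrix (Fin m) (Fin m) ℝ) (x : Fin m → ℝ) :
    ‖M *ᵥ x‖ ≤ (∑ i, ∑ j, |M i j|) * ‖x‖ := by
  refine (pi_norm_le_iff_of_nonneg (by positivity)).2 fun i => ?_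
  calc ‖(M *ᵥ x) i‖ ≤ ∑ j, |M i j * x j| := Finset.abs_sum_le_sum_abs (fun j => M i j * x j) Finset.univ
    _ ≤ ∑ j, |M i j| * ‖x‖ := by
        gcongr with j
        rw [abs_mul]
        gcongr
        exact norm_le_pi_norm x j
    _ = (∑ j, |M i j|) * ‖x‖ := by rw [Finset.sum_mul]
    _ ≤ _ := by
        refine mul_le_mul_of_nonneg_right ?_ (norm_nonneg _)
        exact Finset.single_le_sum (f := fun i => ∑ j, |M i j|) (fun i _ => by positivity)
          (Finset.mem_univ i)

/-- Global existence on `[0, T]` for a linear initial value problem with continuous coefficients. -/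
lemma exists_linear_forward {m : ℕ} {T : ℝ} (hT : 0 < T)
    {M : ℝ → Matrix (Fin m) (Fin m) ℝ} {b : ℝ → Fin m → ℝ}
    (hM : ∀ i j, ContinuousOn (fun t => M t i j) (Icc 0 T))
    (hb : ∀ i, ContinuousOn (fun t => b t i) (Icc 0 T)) :
    ∃ x : ℝ → Fin m → ℝ, x 0 = 0 ∧
      ∀ t ∈ Icc 0 T, HasDerivWithinAt x (M t *ᵥ x t + b t) (Icc 0 T) t := by
  obtain ⟨μ, hμ⟩ := isCompact_Icc.exists_bound_of_continuousOn
    (f := fun t => ∑ i, ∑ j, |M t i j|) (s := Icc 0 T)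
    (continuousOn_finsetSum _ fun i _ => continuousOn_finsetSum _ fun j _ => (hM i j).abs)
  obtain ⟨c, hc⟩ := isCompact_Icc.exists_bound_of_continuousOn (continuousOn_pi.2 hb)
  have h0 : (0 : ℝ) ∈ Icc 0 T := ⟨le_rfl, hT.le⟩
  have hμ0 : 0 ≤ μ := (norm_nonneg _).trans (hμ 0 h0)
  have hc0 : 0 ≤ c := (norm_nonneg _).trans (hc 0 h0)
  have hMx : ∀ t ∈ Icc 0 T, ∀ x, ‖M t *ᵥ x‖ ≤ μ * ‖x‖ := fun t ht x =>
    (norm_mulVec_le_sum_abs _ _).trans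
      (mul_le_mul_of_nonneg_right ((le_abs_self _).trans (hμ t ht)) (norm_nonneg _))
  set κ : ℝ := μ + c + 1 with hκ
  have hκ0 : 0 < κ := by positivity
  set ρ : ℝ := Real.exp (κ * T) with hρ
  have hρ0 : 0 ≤ ρ := (Real.exp_pos _).le
  let f : ℝ → (Fin m → ℝ) → (Fin m → ℝ) := fun t x => M t *ᵥ clampFun ρ x + b t
  have hpl : IsPicardLindelof f (⟨0, h0⟩ : Icc 0 T) (0 : Fin m → ℝ)
      (⟨(μ * ρ + c) * T, by positivity⟩) 0 ⟨μ * ρ + c, by positivity⟩ ⟨μ, hμ0⟩ := by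
    constructor
    · intro t ht
      refine LipschitzOnWith.of_dist_le_mul fun x _ y _ => ?_
      rw [dist_eq_norm, dist_eq_norm]
      have : f t x - f t y = M t *ᵥ (clampFun ρ x - clampFun ρ y) := by
        simp [f, Matrix.mulVec_sub]
      rw [this]
      exact (hMx t ht _).trans (mul_le_mul_of_nonneg_left (norm_clampFun_sub_le _ _ _) hμ0)
    · intro x _
      refine continuousOn_pi.2 fun i => ?_
      refine ContinuousOn.add ?_ (hb i)
      exact continuousOn_finsetSum Finset.univ fun j _ =>
        (hM i j).mul (continuousOn_const (c := clampFun ρ x j))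
    · intro t ht x _
      refine (norm_add_le _ _).trans (add_le_add ((hMx t ht _).trans ?_) (hc t ht))
      exact mul_le_mul_of_nonneg_left (norm_clampFun_le_level hρ0 x) hμ0
    · simp only [sub_zero, NNReal.coe_zero, max_eq_left hT.le]
      exact le_rfl
  obtain ⟨x, hx0, hx⟩ := hpl.exists_eq_forall_mem_Icc_hasDerivWithinAt₀
  have hx0' : x 0 = 0 := hx0
  have hB : ∀ t : ℝ, HasDerivAt (fun s => Real.exp (κ * s)) (κ * Real.exp (κ * t)) t := by
    intro t
    refine (((hasDerivAt_id t).const_mul κ).exp).congr_deriv ?_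
    simp only [id]; ring
  have key := image_norm_le_of_norm_deriv_right_lt_deriv_boundary (a := 0) (b := T)
    (f := x) (f' := fun t => f t (x t)) (fun t ht => (hx t ht).continuousWithinAt)
    (fun t ht => hasDerivWithinAt_Ici_of_Icc (hx t (Ico_subset_Icc_self ht)) ht)
    (by simp [hx0']) hB (by
      intro t ht heq
      have ht' := Ico_subset_Icc_self ht
      have h1 : ‖f t (x t)‖ ≤ μ * ‖x t‖ + c :=
        (norm_add_le _ _).trans (add_le_add ((hMx t ht' _).trans
          (mul_le_mul_of_nonneg_left (norm_clampFun_le hρ0 _) hμ0)) (hc t ht'))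
      have h2 : 1 ≤ Real.exp (κ * t) := Real.one_le_exp (mul_nonneg hκ0.le ht.1)
      rw [heq] at h1
      have : c ≤ c * Real.exp (κ * t) := le_mul_of_one_le_right hc0 h2
      rw [hκ] at *
      linarith)
  refine ⟨x, hx0', fun t ht => ?_⟩
  have hle : ‖x t‖ ≤ ρ := (key ht).trans (by
    rw [hρ]; gcongr; exact ht.2)
  have := hx t ht
  simp only [f, clampFun_eq_self hle] at this
  exact this

/-- Global existence on `[0, T]` for a linear terminal value problem with continuous
coefficients. -/
lemma exists_linear_backward {m : ℕ} {T : ℝ} (hT : 0 < T)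
    {M : ℝ → Matrix (Fin m) (Fin m) ℝ} {b : ℝ → Fin m → ℝ}
    (hM : ∀ i j, ContinuousOn (fun t => M t i j) (Icc 0 T))
    (hb : ∀ i, ContinuousOn (fun t => b t i) (Icc 0 T)) :
    ∃ x : ℝ → Fin m → ℝ, x T = 0 ∧
      ∀ t ∈ Icc 0 T, HasDerivWithinAt x (M t *ᵥ x t + b t) (Icc 0 T) t := by
  have hrev : ContinuousOn (fun s : ℝ => T - s) (Icc 0 T) := by fun_prop
  obtain ⟨x, hx0, hx⟩ := exists_linear_forward hT (M := fun s => - M (T - s))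
    (b := fun s => - b (T - s))
    (fun i j => ((hM i j).comp hrev fun _ => sub_mem_Icc_zero).neg)
    (fun i => ((hb i).comp hrev fun _ => sub_mem_Icc_zero).neg)
  refine ⟨fun s => x (T - s), by simpa using hx0, fun t ht => ?_⟩
  refine (hasDerivWithinAt_reverse_Icc (hx _ (sub_mem_Icc_zero ht))).congr_deriv ?_
  simp [Matrix.neg_mulVec, add_comm]

section BlockMatrices

variable {N : ℕ} {a b c : ℕ}

/-- The block matrix `I_N ⊗ F + 𝟏_{N×N} ⊗ (K / N)`. -/
noncomputable def blockSum (N : ℕ) (F K : Matrix (Fin a) (Fin b) ℝ) :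
    Matrix (Fin N × Fin a) (Fin N × Fin b) ℝ :=
  Matrix.of fun x y => (if x.1 = y.1 then F x.2 y.2 else 0) + K x.2 y.2 / (N : ℝ)

lemma blockSum_transpose (F K : Matrix (Fin a) (Fin b) ℝ) :
    (blockSum N F K)ᵀ = blockSum N Fᵀ Kᵀ := by
  ext x y
  simp [blockSum, eq_comm]

lemma kronIN_eq_blockSum (F : Matrix (Fin a) (Fin b) ℝ) : kronIN N F = blockSum N F 0 := by
  ext x y
  simp [blockSum, kronIN]

lemma blockSum_mul_stackN (hN : (N : ℝ) ≠ 0) (F K : Matrix (Fin a) (Fin b) ℝ)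
    (X : Matrix (Fin b) (Fin c) ℝ) :
    blockSum N F K * stackN N X = stackN N ((F + K) * X) := by
  ext x y
  simp only [blockSum, stackN, Matrix.mul_apply, Matrix.of_apply, Fintype.sum_prod_type,
    add_mul, ite_mul, zero_mul, Finset.sum_add_distrib, Matrix.add_apply]
  congr 1
  · rw [Finset.sum_comm]
    simp
  · simp only [Finset.sum_const, Finset.card_univ, Fintype.card_fin, nsmul_eq_mul, Finset.mul_sum]
    refine Finset.sum_congr rfl fun k _ => ?_
    field_simp

lemma stackN_transpose_mul_stackN (X : Matrix (Fin b) (Fin a) ℝ) (Y : Matrix (Fin b) (Fin c) ℝ) :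
    (stackN N X)ᵀ * stackN N Y = (N : ℝ) • (Xᵀ * Y) := by
  ext x y
  simp [stackN, Matrix.mul_apply, Fintype.sum_prod_type]

lemma stackN_add (X Y : Matrix (Fin a) (Fin b) ℝ) :
    stackN N X + stackN N Y = stackN N (X + Y) := rfl

lemma stackN_sub (X Y : Matrix (Fin a) (Fin b) ℝ) :
    stackN N X - stackN N Y = stackN N (X - Y) := rfl

lemma blockSum_mul_blockSum (hN : (N : ℝ) ≠ 0) (F K : Matrix (Fin a) (Fin b) ℝ)
    (F' K' : Matrix (Fin b) (Fin c) ℝ) :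
    blockSum N F K * blockSum N F' K' =
      blockSum N (F * F') ((F + K) * (F' + K') - F * F') := by
  have h : (F + K) * (F' + K') - F * F' = K * F' + F * K' + K * K' := by
    simp only [Matrix.add_mul, Matrix.mul_add]; abel
  rw [h]
  ext x y
  simp only [blockSum, Matrix.mul_apply, Matrix.of_apply, Fintype.sum_prod_type,
    add_mul, mul_add, Finset.sum_add_distrib, Matrix.add_apply, add_div, add_assoc]
  simp only [ite_mul, mul_ite, zero_mul, mul_zero]
  congr 1
  · rw [Finset.sum_comm]
    by_cases hxy : x.1 = y.1 <;> simp [hxy]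
  congr 1
  · rw [Finset.sum_comm]
    simp [Finset.sum_div, div_mul_eq_mul_div]
  congr 1
  · rw [Finset.sum_comm]
    simp [Finset.sum_div, mul_div_assoc]
  · simp only [Finset.sum_const, Finset.card_univ, Fintype.card_fin, nsmul_eq_mul,
      Finset.mul_sum, Finset.sum_div]
    refine Finset.sum_congr rfl fun k _ => ?_
    field_simp

lemma blockSum_one_zero : blockSum N (1 : Matrix (Fin a) (Fin a) ℝ) 0 = 1 := by
  ext x y
  simp only [blockSum, Matrix.of_apply, Matrix.one_apply, Matrix.zero_apply, zero_div, add_zero,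
    Prod.ext_iff]
  split_ifs <;> simp_all

lemma blockSum_inv (hN : (N : ℝ) ≠ 0) {F K : Matrix (Fin a) (Fin a) ℝ}
    (hF : IsUnit F.det) (hFK : IsUnit (F + K).det) :
    (blockSum N F K)⁻¹ = blockSum N F⁻¹ ((F + K)⁻¹ - F⁻¹) := by
  refine Matrix.inv_eq_right_inv ?_
  rw [blockSum_mul_blockSum hN, add_sub_cancel, Matrix.mul_nonsing_inv _ hF,
    Matrix.mul_nonsing_inv _ hFK, sub_self, blockSum_one_zero]

lemma blockSum_inv_mul_stackN (hN : (N : ℝ) ≠ 0) {F K : Matrix (Fin a) (Fin a) ℝ}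
    (hF : IsUnit F.det) (hFK : IsUnit (F + K).det) (X : Matrix (Fin a) (Fin c) ℝ) :
    (blockSum N F K)⁻¹ * stackN N X = stackN N ((F + K)⁻¹ * X) := by
  rw [blockSum_inv hN hF hFK, blockSum_mul_stackN hN, add_sub_cancel]

lemma blockPN_eq_blockSum (Λ₁ Λ₂ : Matrix (Fin a) (Fin a) ℝ) :
    blockPN N a Λ₁ Λ₂ = blockSum N (Λ₁ - (1 / (N : ℝ)) • Λ₂) Λ₂ := by
  ext x y
  simp only [blockPN, blockSum, Matrix.of_apply, Matrix.sub_apply, Matrix.smul_apply, smul_eq_mul]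
  split_ifs <;> ring

lemma blockPN_mul_stackN (hN : (N : ℝ) ≠ 0) (Λ₁ Λ₂ : Matrix (Fin a) (Fin a) ℝ)
    (X : Matrix (Fin a) (Fin c) ℝ) :
    blockPN N a Λ₁ Λ₂ * stackN N X = stackN N ((Λ₁ + (1 - 1 / (N : ℝ)) • Λ₂) * X) := by
  rw [blockPN_eq_blockSum, blockSum_mul_stackN hN]
  congr 2
  rw [sub_smul, one_smul]
  abel

end BlockMatrices

namespace Params

variable {n n₁ N : ℕ} (p : Params n n₁)

lemma bigBhat_eq : p.bigBhat N = blockSum N p.B 0 := kronIN_eq_blockSum p.B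

lemma bigA_eq : p.bigA N = blockSum N p.A p.G := rfl

lemma bigD0_eq : p.bigD0 N = stackN N p.D0 := rfl

lemma bigB0_eq : p.bigB0 N = stackN N ((1 / (N : ℝ)) • p.B0) := by
  ext x y
  simp [bigB0, stackN, div_eq_inv_mul]

/-- Sandwiching the block matrix between matrices supported on the `i`-th block row picks out
the diagonal block. -/
lemma blockRow_transpose_mul_blockPN_mul {c d : ℕ} (i : Fin N) (Λ₁ Λ₂ : Matrix (Fin n) (Fin n) ℝ)
    (U : Matrix (Fin n) (Fin c) ℝ) (V : Matrix (Fin n) (Fin d) ℝ) :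
    (Matrix.of fun (x : Fin N × Fin n) l => if x.1 = i then U x.2 l else 0)ᵀ *
      blockPN N n Λ₁ Λ₂ *
      (Matrix.of fun (x : Fin N × Fin n) l => if x.1 = i then V x.2 l else 0) =
      Uᵀ * Λ₁ * V := by
  ext k l
  simp only [Matrix.mul_apply, Matrix.transpose_apply, Matrix.of_apply, Fintype.sum_prod_type,
    blockPN, ite_mul, mul_ite, zero_mul, mul_zero]
  rw [Finset.sum_comm]
  simp only [Finset.sum_ite_eq', Finset.mem_univ, if_true]
  refine Finset.sum_congr rfl fun m _ => ?_
  congr 1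
  rw [Finset.sum_comm]
  refine Finset.sum_congr rfl fun j _ => ?_
  rw [Finset.sum_eq_single i (fun b _ hb => by simp only [if_neg hb])
    (fun h => absurd (Finset.mem_univ i) h)]
  simp

lemma transpose_stackN_mul_blockPN_mul_stackN {c d : ℕ} (hN : (N : ℝ) ≠ 0)
    (Λ₁ Λ₂ : Matrix (Fin n) (Fin n) ℝ)
    (U : Matrix (Fin n) (Fin c) ℝ) (V : Matrix (Fin n) (Fin d) ℝ) :
    (stackN N U)ᵀ * blockPN N n Λ₁ Λ₂ * stackN N V =
      (N : ℝ) • (Uᵀ * (Λ₁ + (1 - 1 / (N : ℝ)) • Λ₂) * V) := by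
  rw [Matrix.mul_assoc, blockPN_mul_stackN hN, stackN_transpose_mul_stackN, Matrix.mul_assoc]

lemma two_smul_M0_blockPN (hN : (N : ℝ) ≠ 0) (Λ₁ Λ₂ : Matrix (Fin n) (Fin n) ℝ) :
    (2 : ℝ) • p.M0 N (blockPN N n Λ₁ Λ₂) =
      (N : ℝ) • (p.Dᵀ * Λ₁ * p.D + p.D0ᵀ * (Λ₁ + (1 - 1 / (N : ℝ)) • Λ₂) * p.D0) := by
  have h : ∀ i : Fin N, (p.bigD N i)ᵀ * blockPN N n Λ₁ Λ₂ * p.bigD N i = p.Dᵀ * Λ₁ * p.D :=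
    fun i => blockRow_transpose_mul_blockPN_mul i Λ₁ Λ₂ p.D p.D
  simp only [M0, h, bigD0_eq, transpose_stackN_mul_blockPN_mul_stackN hN, Finset.sum_const,
    Finset.card_univ, Fintype.card_fin]
  rw [smul_add, smul_smul, smul_smul, ← Nat.cast_smul_eq_nsmul ℝ]
  norm_num

lemma mul_bigE_sum (Z : Matrix (Fin 1) (Fin n₁) ℝ) :
    ∑ i : Fin N, Z * p.bigE N i = (stackN N Zᵀ)ᵀ := by
  ext x y
  simp only [Matrix.sum_apply, Matrix.mul_apply, bigE, Matrix.of_apply, stackN,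
    Matrix.transpose_apply, mul_ite, mul_one, mul_zero, ite_and]
  simp

lemma mul_bigIhat {c : ℕ} (Z : Matrix (Fin c) (Fin n₁) ℝ) :
    Z * p.bigIhat N = (stackN N Zᵀ)ᵀ := by
  ext x y
  simp [Matrix.mul_apply, bigIhat, stackN]

lemma M1_blockPN (hN : (N : ℝ) ≠ 0) (Λ₁ Λ₂ : Matrix (Fin n) (Fin n) ℝ) :
    p.M1 N (blockPN N n Λ₁ Λ₂) =
      (stackN N (p.Dᵀ * Λ₁ * p.B1 + p.D0ᵀ * (Λ₁ + (1 - 1 / (N : ℝ)) • Λ₂) * p.B0)ᵀ)ᵀ := by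
  have h : ∀ i : Fin N, (p.bigD N i)ᵀ * blockPN N n Λ₁ Λ₂ * p.bigB N i = p.Dᵀ * Λ₁ * p.B1 :=
    fun i => blockRow_transpose_mul_blockPN_mul i Λ₁ Λ₂ p.D p.B1
  simp only [M1, h, bigD0_eq, bigB0_eq, transpose_stackN_mul_blockPN_mul_stackN hN, mul_bigE_sum,
    mul_bigIhat]
  rw [← Matrix.transpose_add, stackN_add, ← Matrix.transpose_add, Matrix.mul_smul, smul_smul,
    mul_one_div_cancel hN, one_smul]

lemma bigR_add_two_smul_M2_blockPN (hN : (N : ℝ) ≠ 0) (Λ₁ Λ₂ : Matrix (Fin n) (Fin n) ℝ) :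
    p.bigR N + (2 : ℝ) • p.M2 N (blockPN N n Λ₁ Λ₂) =
      blockSum N (p.R1 Λ₁) (p.B0ᵀ * (Λ₁ + (1 - 1 / (N : ℝ)) • Λ₂) * p.B0) := by
  have h1 : ∀ i : Fin N, (p.bigE N i)ᵀ * (p.bigB N i)ᵀ * blockPN N n Λ₁ Λ₂ * p.bigB N i *
      p.bigE N i = (p.bigE N i)ᵀ * (p.B1ᵀ * Λ₁ * p.B1) * p.bigE N i := fun i => by
    rw [← blockRow_transpose_mul_blockPN_mul i Λ₁ Λ₂ p.B1 p.B1]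
    simp only [Matrix.mul_assoc]
    rfl
  have h2 : (p.bigIhat N)ᵀ * (p.bigB0 N)ᵀ * blockPN N n Λ₁ Λ₂ * p.bigB0 N * p.bigIhat N =
      (p.bigIhat N)ᵀ * ((1 / (N : ℝ)) • (p.B0ᵀ * (Λ₁ + (1 - 1 / (N : ℝ)) • Λ₂) * p.B0)) *
        p.bigIhat N := by
    have h3 : (p.bigB0 N)ᵀ * blockPN N n Λ₁ Λ₂ * p.bigB0 N =
        (1 / (N : ℝ)) • (p.B0ᵀ * (Λ₁ + (1 - 1 / (N : ℝ)) • Λ₂) * p.B0) := by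
      rw [bigB0_eq, transpose_stackN_mul_blockPN_mul_stackN hN, Matrix.transpose_smul,
        Matrix.mul_smul, Matrix.smul_mul, Matrix.smul_mul, smul_smul, mul_one_div_cancel hN,
        one_smul]
    rw [← h3]
    simp only [Matrix.mul_assoc]
  simp only [M2, h1, h2, R1]
  generalize p.B1ᵀ * Λ₁ * p.B1 = Y
  generalize p.B0ᵀ * (Λ₁ + (1 - 1 / (N : ℝ)) • Λ₂) * p.B0 = Z
  ext x y
  have e1 : ∀ i : Fin N, ((p.bigE N i)ᵀ * Y * p.bigE N i) x y =
      if x.1 = i then if y.1 = i then Y x.2 y.2 else 0 else 0 := fun i => by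
    simp only [Matrix.mul_apply, bigE, Matrix.transpose_apply, Matrix.of_apply, ite_and]
    split_ifs <;> simp
  have e2 : ((p.bigIhat N)ᵀ * ((1 / (N : ℝ)) • Z) * p.bigIhat N) x y = Z x.2 y.2 / N := by
    simp [Matrix.mul_apply, bigIhat, div_eq_inv_mul]
  simp only [bigR, blockSum, Matrix.add_apply, Matrix.smul_apply, Matrix.sum_apply, e1, e2,
    Matrix.of_apply, smul_eq_mul, Finset.sum_ite_eq, Finset.mem_univ, if_true]
  by_cases hxy : x.1 = y.1
  · simp [hxy]; ring
  · simp [hxy, Ne.symm hxy]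

/-! The vector fields of the rescaled systems, with `1 / N` replaced by a real parameter `ε`. -/

/-- `Λ₁ + (1 - ε) Λ₂`. -/
noncomputable def blendE (ε : ℝ) (Λ₁ Λ₂ : Matrix (Fin n) (Fin n) ℝ) : Matrix (Fin n) (Fin n) ℝ :=
  Λ₁ + (1 - ε) • Λ₂

/-- `ℛ₂(Λ₁, Λ₂) - ε B₀ᵀ Λ₂ B₀`. -/
noncomputable def KE (ε : ℝ) (Λ₁ Λ₂ : Matrix (Fin n) (Fin n) ℝ) : Matrix (Fin n₁) (Fin n₁) ℝ :=
  p.R2 Λ₁ Λ₂ - ε • (p.B0ᵀ * Λ₂ * p.B0)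

/-- The difference of the inverses of `KE` and `R1`. -/
noncomputable def DE (ε : ℝ) (Λ₁ Λ₂ : Matrix (Fin n) (Fin n) ℝ) : Matrix (Fin n₁) (Fin n₁) ℝ :=
  (p.KE ε Λ₁ Λ₂)⁻¹ - (p.R1 Λ₁)⁻¹

/-- Right-hand side of the equation for `Λ₁`. -/
noncomputable def field1 (ε : ℝ) (Λ₁ Λ₂ : Matrix (Fin n) (Fin n) ℝ) : Matrix (Fin n) (Fin n) ℝ :=
  Λ₁ * p.B * (p.R1 Λ₁)⁻¹ * p.Bᵀ * Λ₁ - Λ₁ * p.A - p.Aᵀ * Λ₁ - p.Q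
  + (Λ₁ * p.B * (ε • p.DE ε Λ₁ Λ₂) * p.Bᵀ * Λ₁
  + (1 - ε) •
      (Λ₂ * p.B * (ε • p.DE ε Λ₁ Λ₂) * p.Bᵀ * Λ₁ + Λ₁ * p.B * (ε • p.DE ε Λ₁ Λ₂) * p.Bᵀ * Λ₂)
  + (ε - ε ^ 2) •
      (Λ₂ * p.B * ((p.R1 Λ₁)⁻¹ + (1 - ε) • p.DE ε Λ₁ Λ₂) * p.Bᵀ * Λ₂)
  - ε • ((Λ₁ * p.G + p.Gᵀ * Λ₁) + (1 - ε) • (Λ₂ * p.G + p.Gᵀ * Λ₂))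
  - ε • p.QΓ)

/-- Right-hand side of the equation for `Λ₂`. -/
noncomputable def field2 (ε : ℝ) (Λ₁ Λ₂ : Matrix (Fin n) (Fin n) ℝ) : Matrix (Fin n) (Fin n) ℝ :=
  (Λ₁ + Λ₂) * p.B * (p.R2 Λ₁ Λ₂)⁻¹ * p.Bᵀ * (Λ₁ + Λ₂)
    - Λ₁ * p.B * (p.R1 Λ₁)⁻¹ * p.Bᵀ * Λ₁
    - (Λ₁ * p.G + Λ₂ * (p.A + p.G))
    - (p.Gᵀ * Λ₁ + (p.Aᵀ + p.Gᵀ) * Λ₂)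
    - p.QΓ
  + ((Λ₁ + Λ₂) * p.B * (p.DE ε Λ₁ Λ₂ + (p.R1 Λ₁)⁻¹ - (p.R2 Λ₁ Λ₂)⁻¹) * p.Bᵀ * (Λ₁ + Λ₂)
  - (2 * ε) • (Λ₂ * p.B * (p.R1 Λ₁)⁻¹ * p.Bᵀ * Λ₂)
  + (ε - 2) • (Λ₂ * p.B * (ε • p.DE ε Λ₁ Λ₂) * p.Bᵀ * Λ₂)
  - Λ₁ * p.B * (ε • p.DE ε Λ₁ Λ₂) * p.Bᵀ * Λ₂
  - Λ₂ * p.B * (ε • p.DE ε Λ₁ Λ₂) * p.Bᵀ * Λ₁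
  + ε • (Λ₂ * p.G + p.Gᵀ * Λ₂))

/-- Right-hand side of the equation for `S`. -/
noncomputable def fieldS (ε : ℝ) (Λ₁ Λ₂ : Matrix (Fin n) (Fin n) ℝ) (S : Matrix (Fin n) (Fin 1) ℝ) :
    Matrix (Fin n) (Fin 1) ℝ :=
  blendE ε Λ₁ Λ₂ * p.B * (p.KE ε Λ₁ Λ₂)⁻¹ *
      (p.Bᵀ * S + p.B1ᵀ * Λ₁ * p.D + p.B0ᵀ * blendE ε Λ₁ Λ₂ * p.D0)
    - (p.A + p.G)ᵀ * S

/-- Right-hand side of the equation for `r`. -/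
noncomputable def fieldr (ε : ℝ) (Λ₁ Λ₂ : Matrix (Fin n) (Fin n) ℝ) (S : Matrix (Fin n) (Fin 1) ℝ) :
    Matrix (Fin 1) (Fin 1) ℝ :=
  (Sᵀ * p.B + p.Dᵀ * Λ₁ * p.B1 + p.D0ᵀ * blendE ε Λ₁ Λ₂ * p.B0) * (p.KE ε Λ₁ Λ₂)⁻¹ *
      (p.Bᵀ * S + p.B1ᵀ * Λ₁ * p.D + p.B0ᵀ * blendE ε Λ₁ Λ₂ * p.D0)
    - p.Dᵀ * Λ₁ * p.D - p.D0ᵀ * blendE ε Λ₁ Λ₂ * p.D0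

lemma blendE_zero (Λ₁ Λ₂ : Matrix (Fin n) (Fin n) ℝ) : blendE 0 Λ₁ Λ₂ = Λ₁ + Λ₂ := by
  simp [blendE]

lemma KE_zero (Λ₁ Λ₂ : Matrix (Fin n) (Fin n) ℝ) : p.KE 0 Λ₁ Λ₂ = p.R2 Λ₁ Λ₂ := by
  simp [KE]

lemma KE_eq (ε : ℝ) (Λ₁ Λ₂ : Matrix (Fin n) (Fin n) ℝ) :
    p.KE ε Λ₁ Λ₂ = p.R1 Λ₁ + p.B0ᵀ * blendE ε Λ₁ Λ₂ * p.B0 := by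
  simp only [KE, R2, R1, blendE, Matrix.mul_add, Matrix.add_mul, sub_smul, one_smul,
    Matrix.mul_sub, Matrix.sub_mul, Matrix.mul_smul, Matrix.smul_mul]
  abel

lemma field1_zero (Λ₁ Λ₂ : Matrix (Fin n) (Fin n) ℝ) : p.field1 0 Λ₁ Λ₂ = p.Ψ₁ Λ₁ := by
  simp [field1, Ψ₁]

lemma field2_zero (Λ₁ Λ₂ : Matrix (Fin n) (Fin n) ℝ) : p.field2 0 Λ₁ Λ₂ = p.Ψ₂ Λ₁ Λ₂ := by
  simp [field2, Ψ₂, DE, KE_zero]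

lemma fieldS_zero (Λ₁ Λ₂ : Matrix (Fin n) (Fin n) ℝ) (S : Matrix (Fin n) (Fin 1) ℝ) :
    p.fieldS 0 Λ₁ Λ₂ S = p.φ₁ Λ₁ Λ₂ S := by
  simp only [fieldS, φ₁, KE_zero, blendE_zero]

lemma fieldr_zero (Λ₁ Λ₂ : Matrix (Fin n) (Fin n) ℝ) (S : Matrix (Fin n) (Fin 1) ℝ) :
    p.fieldr 0 Λ₁ Λ₂ S = p.φ₂ Λ₁ Λ₂ S := by
  simp only [fieldr, φ₂, KE_zero, blendE_zero]

lemma EN_eq (Λ₁ Λ₂ : Matrix (Fin n) (Fin n) ℝ) :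
    p.EN N Λ₁ Λ₂ = (1 / (N : ℝ)) • p.DE (1 / (N : ℝ)) Λ₁ Λ₂ := rfl

lemma HN_add_smul_EN (hN : (N : ℝ) ≠ 0) (Λ₁ Λ₂ : Matrix (Fin n) (Fin n) ℝ) :
    p.HN N Λ₁ Λ₂ + ((N : ℝ) - 2) • p.EN N Λ₁ Λ₂ =
      (p.R1 Λ₁)⁻¹ + (1 - 1 / (N : ℝ)) • p.DE (1 / (N : ℝ)) Λ₁ Λ₂ := by
  have h : (1 - 1 / (N : ℝ)) = 1 / (N : ℝ) + ((N : ℝ) - 2) * (1 / (N : ℝ)) := by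
    field_simp; ring
  rw [HN, EN_eq, h, add_smul, smul_smul]
  abel

lemma field1_inv_nat (hN : (N : ℝ) ≠ 0) (Λ₁ Λ₂ : Matrix (Fin n) (Fin n) ℝ) :
    p.field1 (1 / (N : ℝ)) Λ₁ Λ₂ = p.Ψ₁ Λ₁ + p.g₁ N Λ₁ Λ₂ := by
  rw [g₁, HN_add_smul_EN p hN, EN_eq, Ψ₁, field1, _root_.one_div_pow]

lemma field2_inv_nat (hN : (N : ℝ) ≠ 0) (Λ₁ Λ₂ : Matrix (Fin n) (Fin n) ℝ) :
    p.field2 (1 / (N : ℝ)) Λ₁ Λ₂ = p.Ψ₂ Λ₁ Λ₂ + p.g₂ N Λ₁ Λ₂ := by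
  have h : (N : ℝ) • p.EN N Λ₁ Λ₂ = p.DE (1 / (N : ℝ)) Λ₁ Λ₂ := by
    rw [EN_eq, smul_smul, mul_one_div_cancel hN, one_smul]
  have h2 : 2 / (N : ℝ) = 2 * (1 / (N : ℝ)) := by ring
  rw [g₂, h, EN_eq, Ψ₂, field2, h2]

lemma fieldS_inv_nat (Λ₁ Λ₂ : Matrix (Fin n) (Fin n) ℝ) (S : Matrix (Fin n) (Fin 1) ℝ) :
    p.fieldS (1 / (N : ℝ)) Λ₁ Λ₂ S = p.φ₁ Λ₁ Λ₂ S + p.g01 N Λ₁ Λ₂ S := by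
  simp only [fieldS, φ₁, g01, KE, blendE]
  abel

lemma fieldr_inv_nat (Λ₁ Λ₂ : Matrix (Fin n) (Fin n) ℝ) (S : Matrix (Fin n) (Fin 1) ℝ) :
    p.fieldr (1 / (N : ℝ)) Λ₁ Λ₂ S = p.φ₂ Λ₁ Λ₂ S + p.g02 N Λ₁ Λ₂ S := by
  have h : p.D0ᵀ * blendE (1 / (N : ℝ)) Λ₁ Λ₂ * p.D0 =
      p.D0ᵀ * (Λ₁ + Λ₂) * p.D0 - (1 / (N : ℝ)) • (p.D0ᵀ * Λ₂ * p.D0) := by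
    simp only [blendE, Matrix.mul_add, Matrix.add_mul, sub_smul, one_smul, Matrix.mul_sub,
      Matrix.sub_mul, Matrix.mul_smul, Matrix.smul_mul]
    abel
  rw [fieldr, h]
  simp only [φ₂, g02, KE, blendE]
  abel

lemma transpose_M1_blockPN (hN : (N : ℝ) ≠ 0) {Λ₁ Λ₂ : Matrix (Fin n) (Fin n) ℝ}
    (h1 : Λ₁.IsSymm) (h2 : Λ₂.IsSymm) :
    (p.M1 N (blockPN N n Λ₁ Λ₂))ᵀ =
      stackN N (p.B1ᵀ * Λ₁ * p.D + p.B0ᵀ * blendE (1 / (N : ℝ)) Λ₁ Λ₂ * p.D0) := by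
  rw [M1_blockPN p hN, Matrix.transpose_transpose]
  congr 1
  simp only [blendE, Matrix.transpose_add, Matrix.transpose_mul, Matrix.transpose_transpose,
    Matrix.transpose_smul, h1.eq, h2.eq, Matrix.mul_assoc]

/-- On stacked vectors the right-hand side of (ODE-S) is the stack of the rescaled one. -/
lemma stackedS_rhs (hN : (N : ℝ) ≠ 0) {Λ₁ Λ₂ : Matrix (Fin n) (Fin n) ℝ}
    (h1 : Λ₁.IsSymm) (h2 : Λ₂.IsSymm) (hR : IsUnit (p.R1 Λ₁).det)
    (hK : IsUnit (p.KE (1 / (N : ℝ)) Λ₁ Λ₂).det) (S : Matrix (Fin n) (Fin 1) ℝ) :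
    blockPN N n Λ₁ Λ₂ * p.bigBhat N *
        (p.bigR N + (2 : ℝ) • p.M2 N (blockPN N n Λ₁ Λ₂))⁻¹ *
        ((p.bigBhat N)ᵀ * stackN N S + (p.M1 N (blockPN N n Λ₁ Λ₂))ᵀ) -
        (p.bigA N)ᵀ * stackN N S =
      stackN N (p.fieldS (1 / (N : ℝ)) Λ₁ Λ₂ S) := by
  rw [KE_eq, blendE] at hK
  rw [transpose_M1_blockPN p hN h1 h2, bigR_add_two_smul_M2_blockPN p hN, bigBhat_eq, bigA_eq,
    blockSum_transpose, blockSum_transpose, blockSum_mul_stackN hN, blockSum_mul_stackN hN,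
    stackN_add, Matrix.mul_assoc, blockSum_inv_mul_stackN hN hR hK, Matrix.mul_assoc,
    blockSum_mul_stackN hN, blockPN_mul_stackN hN, stackN_sub, fieldS, KE_eq, blendE]
  simp only [Matrix.transpose_zero, add_zero, Matrix.mul_assoc, Matrix.transpose_add, add_assoc]

/-- On stacked vectors the right-hand side of (ODE-r) is `N` times the rescaled one. -/
lemma stackedr_rhs (hN : (N : ℝ) ≠ 0) {Λ₁ Λ₂ : Matrix (Fin n) (Fin n) ℝ}
    (h1 : Λ₁.IsSymm) (h2 : Λ₂.IsSymm) (hR : IsUnit (p.R1 Λ₁).det)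
    (hK : IsUnit (p.KE (1 / (N : ℝ)) Λ₁ Λ₂).det) (S : Matrix (Fin n) (Fin 1) ℝ) :
    ((stackN N S)ᵀ * p.bigBhat N + p.M1 N (blockPN N n Λ₁ Λ₂)) *
        (p.bigR N + (2 : ℝ) • p.M2 N (blockPN N n Λ₁ Λ₂))⁻¹ *
        ((p.bigBhat N)ᵀ * stackN N S + (p.M1 N (blockPN N n Λ₁ Λ₂))ᵀ) -
        (2 : ℝ) • p.M0 N (blockPN N n Λ₁ Λ₂) =
      (N : ℝ) • p.fieldr (1 / (N : ℝ)) Λ₁ Λ₂ S := by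
  rw [KE_eq, blendE] at hK
  have e : (stackN N S)ᵀ * p.bigBhat N + p.M1 N (blockPN N n Λ₁ Λ₂) =
      (stackN N (p.Bᵀ * S + (p.B1ᵀ * Λ₁ * p.D + p.B0ᵀ * blendE (1 / (N : ℝ)) Λ₁ Λ₂ * p.D0)))ᵀ := by
    rw [← stackN_add, Matrix.transpose_add, ← transpose_M1_blockPN p hN h1 h2,
      Matrix.transpose_transpose]
    congr 1
    rw [bigBhat_eq, ← Matrix.transpose_inj, Matrix.transpose_mul, blockSum_transpose,
      Matrix.transpose_transpose, blockSum_mul_stackN hN, Matrix.transpose_transpose,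
      Matrix.transpose_zero, add_zero]
  rw [e, transpose_M1_blockPN p hN h1 h2, bigR_add_two_smul_M2_blockPN p hN, bigBhat_eq,
    blockSum_transpose, blockSum_mul_stackN hN, stackN_add, Matrix.mul_assoc,
    blockSum_inv_mul_stackN hN hR hK, stackN_transpose_mul_stackN, two_smul_M0_blockPN p hN,
    ← smul_sub, fieldr, KE_eq]
  have hb : (blendE (1 / (N : ℝ)) Λ₁ Λ₂)ᵀ = blendE (1 / (N : ℝ)) Λ₁ Λ₂ := by
    simp only [blendE, Matrix.transpose_add, Matrix.transpose_smul, h1.eq, h2.eq]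
  have hb' : Λ₁ + (1 - 1 / (N : ℝ)) • Λ₂ = blendE (1 / (N : ℝ)) Λ₁ Λ₂ := rfl
  simp only [hb', Matrix.transpose_zero, add_zero, Matrix.mul_assoc, Matrix.transpose_add,
    add_assoc, Matrix.transpose_mul, Matrix.transpose_transpose, h1.eq, hb, sub_sub]

end Params

section EntrywiseSmooth

variable {X : Type*} [NormedAddCommGroup X] [NormedSpace ℝ X] {a b c : ℕ} {x : X}

/-- All entries of the matrix-valued function `M` are `C¹` at `x`. -/
def EntrySmoothAt (M : X → Matrix (Fin a) (Fin b) ℝ) (x : X) : Prop :=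
  ∀ i j, ContDiffAt ℝ 1 (fun y => M y i j) x

lemma entrySmoothAt_const (M : Matrix (Fin a) (Fin b) ℝ) : EntrySmoothAt (fun _ => M) x :=
  fun _ _ => contDiffAt_const

lemma EntrySmoothAt.add {M K : X → Matrix (Fin a) (Fin b) ℝ} (hM : EntrySmoothAt M x)
    (hK : EntrySmoothAt K x) : EntrySmoothAt (fun y => M y + K y) x :=
  fun i j => (hM i j).add (hK i j)

lemma EntrySmoothAt.sub {M K : X → Matrix (Fin a) (Fin b) ℝ} (hM : EntrySmoothAt M x)
    (hK : EntrySmoothAt K x) : EntrySmoothAt (fun y => M y - K y) x :=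
  fun i j => (hM i j).sub (hK i j)

lemma EntrySmoothAt.smul {f : X → ℝ} {M : X → Matrix (Fin a) (Fin b) ℝ} (hf : ContDiffAt ℝ 1 f x)
    (hM : EntrySmoothAt M x) : EntrySmoothAt (fun y => f y • M y) x :=
  fun i j => hf.mul (hM i j)

lemma EntrySmoothAt.mul {M : X → Matrix (Fin a) (Fin b) ℝ} {K : X → Matrix (Fin b) (Fin c) ℝ}
    (hM : EntrySmoothAt M x) (hK : EntrySmoothAt K x) : EntrySmoothAt (fun y => M y * K y) x :=
  fun i j => by
    simp only [Matrix.mul_apply]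
    exact ContDiffAt.sum fun k _ => (hM i k).mul (hK k j)

lemma EntrySmoothAt.transpose {M : X → Matrix (Fin a) (Fin b) ℝ} (hM : EntrySmoothAt M x) :
    EntrySmoothAt (fun y => (M y)ᵀ) x :=
  fun i j => hM j i

lemma EntrySmoothAt.det {M : X → Matrix (Fin a) (Fin a) ℝ} (hM : EntrySmoothAt M x) :
    ContDiffAt ℝ 1 (fun y => (M y).det) x := by
  simp only [Matrix.det_apply']
  exact ContDiffAt.sum fun σ _ => contDiffAt_const.mul (contDiffAt_prod fun i _ => hM (σ i) i)

lemma EntrySmoothAt.inv {M : X → Matrix (Fin a) (Fin a) ℝ} (hM : EntrySmoothAt M x)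
    (hx : (M x).det ≠ 0) : EntrySmoothAt (fun y => (M y)⁻¹) x := fun i j => by
  simp only [Matrix.inv_def, Ring.inverse_eq_inv', Matrix.smul_apply, smul_eq_mul,
    Matrix.adjugate_apply]
  refine (hM.det.inv hx).mul (EntrySmoothAt.det fun k l => ?_)
  simp only [Matrix.updateRow_apply]
  split_ifs
  · exact contDiffAt_const
  · exact hM k l

end EntrywiseSmooth

namespace Params

variable {n n₁ N : ℕ} (p : Params n n₁)

section FieldSmooth

variable {X : Type*} [NormedAddCommGroup X] [NormedSpace ℝ X] {x : X} {e : X → ℝ}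
  {L₁ L₂ : X → Matrix (Fin n) (Fin n) ℝ} {S : X → Matrix (Fin n) (Fin 1) ℝ}

lemma entrySmoothAt_blendE (he : ContDiffAt ℝ 1 e x) (h1 : EntrySmoothAt L₁ x)
    (h2 : EntrySmoothAt L₂ x) : EntrySmoothAt (fun y => blendE (e y) (L₁ y) (L₂ y)) x :=
  h1.add (.smul (contDiffAt_const.sub he) h2)

lemma entrySmoothAt_R1 (h1 : EntrySmoothAt L₁ x) : EntrySmoothAt (fun y => p.R1 (L₁ y)) x :=
  (entrySmoothAt_const _).add (((entrySmoothAt_const _).mul h1).mul (entrySmoothAt_const _))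

lemma entrySmoothAt_R2 (h1 : EntrySmoothAt L₁ x) (h2 : EntrySmoothAt L₂ x) :
    EntrySmoothAt (fun y => p.R2 (L₁ y) (L₂ y)) x :=
  (p.entrySmoothAt_R1 h1).add
    (((entrySmoothAt_const _).mul (h1.add h2)).mul (entrySmoothAt_const _))

lemma entrySmoothAt_KE (he : ContDiffAt ℝ 1 e x) (h1 : EntrySmoothAt L₁ x)
    (h2 : EntrySmoothAt L₂ x) : EntrySmoothAt (fun y => p.KE (e y) (L₁ y) (L₂ y)) x :=
  (p.entrySmoothAt_R2 h1 h2).sub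
    (.smul he (((entrySmoothAt_const _).mul h2).mul (entrySmoothAt_const _)))

lemma entrySmoothAt_field1 (he : ContDiffAt ℝ 1 e x) (h1 : EntrySmoothAt L₁ x)
    (h2 : EntrySmoothAt L₂ x) (hR : (p.R1 (L₁ x)).det ≠ 0)
    (hK : (p.KE (e x) (L₁ x) (L₂ x)).det ≠ 0) :
    EntrySmoothAt (fun y => p.field1 (e y) (L₁ y) (L₂ y)) x := by
  have hi := (p.entrySmoothAt_R1 h1).inv hR
  have hD : EntrySmoothAt (fun y => p.DE (e y) (L₁ y) (L₂ y)) x :=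
    ((p.entrySmoothAt_KE he h1 h2).inv hK).sub hi
  have he' : ContDiffAt ℝ 1 (fun y => 1 - e y) x := contDiffAt_const.sub he
  have hc : ∀ {a b : ℕ} (M : Matrix (Fin a) (Fin b) ℝ), EntrySmoothAt (fun _ : X => M) x :=
    entrySmoothAt_const
  have hE := EntrySmoothAt.smul he hD
  exact (((((((h1.mul (hc _)).mul hi).mul (hc _)).mul h1).sub (h1.mul (hc _))).sub
    ((hc _).mul h1)).sub (hc _)).add
    ((((((((h1.mul (hc _)).mul hE).mul (hc _)).mul h1).add
      (.smul he' (((((h2.mul (hc _)).mul hE).mul (hc _)).mul h1).add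
        ((((h1.mul (hc _)).mul hE).mul (hc _)).mul h2)))).add
      (.smul (he.sub (he.pow 2))
        ((((h2.mul (hc _)).mul (hi.add (.smul he' hD))).mul (hc _)).mul h2))).sub
      (.smul he (((h1.mul (hc _)).add ((hc _).mul h1)).add
        (.smul he' ((h2.mul (hc _)).add ((hc _).mul h2)))))).sub (.smul he (hc _)))

lemma entrySmoothAt_field2 (he : ContDiffAt ℝ 1 e x) (h1 : EntrySmoothAt L₁ x)
    (h2 : EntrySmoothAt L₂ x) (hR : (p.R1 (L₁ x)).det ≠ 0) (hR2 : (p.R2 (L₁ x) (L₂ x)).det ≠ 0)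
    (hK : (p.KE (e x) (L₁ x) (L₂ x)).det ≠ 0) :
    EntrySmoothAt (fun y => p.field2 (e y) (L₁ y) (L₂ y)) x := by
  have hi := (p.entrySmoothAt_R1 h1).inv hR
  have hi2 := (p.entrySmoothAt_R2 h1 h2).inv hR2
  have hD : EntrySmoothAt (fun y => p.DE (e y) (L₁ y) (L₂ y)) x :=
    ((p.entrySmoothAt_KE he h1 h2).inv hK).sub hi
  have hc : ∀ {a b : ℕ} (M : Matrix (Fin a) (Fin b) ℝ), EntrySmoothAt (fun _ : X => M) x :=
    entrySmoothAt_const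
  have hE := EntrySmoothAt.smul he hD
  have h12 := h1.add h2
  exact ((((((((h12.mul (hc _)).mul hi2).mul (hc _)).mul h12).sub
    ((((h1.mul (hc _)).mul hi).mul (hc _)).mul h1)).sub
    ((h1.mul (hc _)).add (h2.mul (hc _)))).sub (((hc _).mul h1).add ((hc _).mul h2))).sub
    (hc _)).add
    (((((((((h12.mul (hc _)).mul ((hD.add hi).sub hi2)).mul (hc _)).mul h12).sub
      (.smul (contDiffAt_const.mul he) ((((h2.mul (hc _)).mul hi).mul (hc _)).mul h2))).add
      (.smul (he.sub contDiffAt_const) ((((h2.mul (hc _)).mul hE).mul (hc _)).mul h2))).sub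
      ((((h1.mul (hc _)).mul hE).mul (hc _)).mul h2)).sub
      ((((h2.mul (hc _)).mul hE).mul (hc _)).mul h1)).add
      (.smul he ((h2.mul (hc _)).add ((hc _).mul h2))))

lemma entrySmoothAt_fieldS (he : ContDiffAt ℝ 1 e x) (h1 : EntrySmoothAt L₁ x)
    (h2 : EntrySmoothAt L₂ x) (hS : EntrySmoothAt S x)
    (hK : (p.KE (e x) (L₁ x) (L₂ x)).det ≠ 0) :
    EntrySmoothAt (fun y => p.fieldS (e y) (L₁ y) (L₂ y) (S y)) x := by
  have hi := (p.entrySmoothAt_KE he h1 h2).inv hK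
  have hb := entrySmoothAt_blendE he h1 h2
  have hc : ∀ {a b : ℕ} (M : Matrix (Fin a) (Fin b) ℝ), EntrySmoothAt (fun _ : X => M) x :=
    entrySmoothAt_const
  exact (((hb.mul (hc _)).mul hi).mul ((((hc _).mul hS).add (((hc _).mul h1).mul (hc _))).add
    (((hc _).mul hb).mul (hc _)))).sub ((hc _).mul hS)

lemma entrySmoothAt_fieldr (he : ContDiffAt ℝ 1 e x) (h1 : EntrySmoothAt L₁ x)
    (h2 : EntrySmoothAt L₂ x) (hS : EntrySmoothAt S x)
    (hK : (p.KE (e x) (L₁ x) (L₂ x)).det ≠ 0) :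
    EntrySmoothAt (fun y => p.fieldr (e y) (L₁ y) (L₂ y) (S y)) x := by
  have hi := (p.entrySmoothAt_KE he h1 h2).inv hK
  have hb := entrySmoothAt_blendE he h1 h2
  have hc : ∀ {a b : ℕ} (M : Matrix (Fin a) (Fin b) ℝ), EntrySmoothAt (fun _ : X => M) x :=
    entrySmoothAt_const
  exact ((((((hS.transpose.mul (hc _)).add (((hc _).mul h1).mul (hc _))).add
    (((hc _).mul hb).mul (hc _))).mul hi).mul
    ((((hc _).mul hS).add (((hc _).mul h1).mul (hc _))).add
    (((hc _).mul hb).mul (hc _)))).sub (((hc _).mul h1).mul (hc _))).sub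
    (((hc _).mul hb).mul (hc _))

end FieldSmooth

/-- The states `(ε, Λ₁, Λ₂, S, r)` of the joint autonomous system. -/
abbrev State (n : ℕ) : Type :=
  ℝ × (Fin n → Fin n → ℝ) × (Fin n → Fin n → ℝ) × (Fin n → Fin 1 → ℝ) × ℝ

/-- The joint autonomous vector field, in which `ε` is constant in time. -/
noncomputable def jointField (z : State n) : State n :=
  (0, fun i j => p.field1 z.1 (Matrix.of z.2.1) (Matrix.of z.2.2.1) i j,
    fun i j => p.field2 z.1 (Matrix.of z.2.1) (Matrix.of z.2.2.1) i j,
    fun i j => p.fieldS z.1 (Matrix.of z.2.1) (Matrix.of z.2.2.1) (Matrix.of z.2.2.2.1) i j,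
    p.fieldr z.1 (Matrix.of z.2.1) (Matrix.of z.2.2.1) (Matrix.of z.2.2.2.1) 0 0)

/-- The state with the given components. -/
def mkState (e : ℝ) (L₁ L₂ : Matrix (Fin n) (Fin n) ℝ) (S : Matrix (Fin n) (Fin 1) ℝ) (r : ℝ) :
    State n :=
  (e, fun i j => L₁ i j, fun i j => L₂ i j, fun i j => S i j, r)

lemma contDiffAt_jointField (e : ℝ) (L₁ L₂ : Matrix (Fin n) (Fin n) ℝ)
    (S : Matrix (Fin n) (Fin 1) ℝ) (r : ℝ) (hR : (p.R1 L₁).det ≠ 0)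
    (hR2 : (p.R2 L₁ L₂).det ≠ 0) (hK : (p.KE e L₁ L₂).det ≠ 0) :
    ContDiffAt ℝ 1 p.jointField (mkState e L₁ L₂ S r) := by
  set z : State n := mkState e L₁ L₂ S r
  have he : ContDiffAt ℝ 1 (fun y : State n => y.1) z := contDiffAt_fst
  have h1 : EntrySmoothAt (fun y : State n => Matrix.of y.2.1) z := fun i j => by
    simp only [Matrix.of_apply]; fun_prop
  have h2 : EntrySmoothAt (fun y : State n => Matrix.of y.2.2.1) z := fun i j => by
    simp only [Matrix.of_apply]; fun_prop
  have hS : EntrySmoothAt (fun y : State n => Matrix.of y.2.2.2.1) z := fun i j => by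
    simp only [Matrix.of_apply]; fun_prop
  refine contDiffAt_const.prodMk (ContDiffAt.prodMk ?_ (.prodMk ?_ (.prodMk ?_ ?_)))
  · exact contDiffAt_pi.2 fun i => contDiffAt_pi.2 fun j =>
      p.entrySmoothAt_field1 he h1 h2 hR hK i j
  · exact contDiffAt_pi.2 fun i => contDiffAt_pi.2 fun j =>
      p.entrySmoothAt_field2 he h1 h2 hR hR2 hK i j
  · exact contDiffAt_pi.2 fun i => contDiffAt_pi.2 fun j =>
      p.entrySmoothAt_fieldS he h1 h2 hS hK i j
  · exact p.entrySmoothAt_fieldr he h1 h2 hS hK 0 0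

lemma hasDerivWithinAt_mkState {s : Set ℝ} {t e : ℝ} {L₁ L₂ : ℝ → Matrix (Fin n) (Fin n) ℝ}
    {S : ℝ → Matrix (Fin n) (Fin 1) ℝ} {r : ℝ → ℝ}
    (h1 : ∀ i j, HasDerivWithinAt (fun u => L₁ u i j) (p.field1 e (L₁ t) (L₂ t) i j) s t)
    (h2 : ∀ i j, HasDerivWithinAt (fun u => L₂ u i j) (p.field2 e (L₁ t) (L₂ t) i j) s t)
    (hS : ∀ i j, HasDerivWithinAt (fun u => S u i j) (p.fieldS e (L₁ t) (L₂ t) (S t) i j) s t)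
    (hr : HasDerivWithinAt r (p.fieldr e (L₁ t) (L₂ t) (S t) 0 0) s t) :
    HasDerivWithinAt (fun u => mkState e (L₁ u) (L₂ u) (S u) (r u))
      (p.jointField (mkState e (L₁ t) (L₂ t) (S t) (r t))) s t :=
  (hasDerivWithinAt_const t s e).prodMk <|
    (hasDerivWithinAt_pi.2 fun i => hasDerivWithinAt_pi.2 fun j => h1 i j).prodMk <|
    (hasDerivWithinAt_pi.2 fun i => hasDerivWithinAt_pi.2 fun j => h2 i j).prodMk <|
    (hasDerivWithinAt_pi.2 fun i => hasDerivWithinAt_pi.2 fun j => hS i j).prodMk hr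

lemma continuousOn_comp_mkState {s : Set ℝ} {e ρ : ℝ} {L₁ L₂ : ℝ → Matrix (Fin n) (Fin n) ℝ}
    {S : ℝ → Matrix (Fin n) (Fin 1) ℝ} {F : State n → ℝ}
    (h1 : ∀ i j, ContinuousOn (fun u => L₁ u i j) s)
    (h2 : ∀ i j, ContinuousOn (fun u => L₂ u i j) s)
    (hS : ∀ i j, ContinuousOn (fun u => S u i j) s)
    (hF : ∀ t ∈ s, ContDiffAt ℝ 1 F (mkState e (L₁ t) (L₂ t) (S t) ρ)) :
    ContinuousOn (fun t => F (mkState e (L₁ t) (L₂ t) (S t) ρ)) s := by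
  have hm : ContinuousOn (fun t => mkState e (L₁ t) (L₂ t) (S t) ρ) s :=
    continuousOn_const.prodMk <|
      (continuousOn_pi.2 fun i => continuousOn_pi.2 fun j => h1 i j).prodMk <|
      (continuousOn_pi.2 fun i => continuousOn_pi.2 fun j => h2 i j).prodMk <|
      (continuousOn_pi.2 fun i => continuousOn_pi.2 fun j => hS i j).prodMk continuousOn_const
  exact fun t ht => (hF t ht).continuousAt.comp_continuousWithinAt
    (f := fun t => mkState e (L₁ t) (L₂ t) (S t) ρ) (hm t ht)

/-- The linear part of `fieldS` in `S`. -/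
noncomputable def fieldSLin (ε : ℝ) (Λ₁ Λ₂ : Matrix (Fin n) (Fin n) ℝ) :
    Matrix (Fin n) (Fin n) ℝ :=
  blendE ε Λ₁ Λ₂ * p.B * (p.KE ε Λ₁ Λ₂)⁻¹ * p.Bᵀ - (p.A + p.G)ᵀ

lemma fieldS_eq_lin_mul_add (ε : ℝ) (Λ₁ Λ₂ : Matrix (Fin n) (Fin n) ℝ)
    (S : Matrix (Fin n) (Fin 1) ℝ) :
    p.fieldS ε Λ₁ Λ₂ S = p.fieldSLin ε Λ₁ Λ₂ * S + p.fieldS ε Λ₁ Λ₂ 0 := by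
  simp only [fieldS, fieldSLin, Matrix.mul_zero, zero_add, sub_zero, Matrix.sub_mul,
    Matrix.mul_add, Matrix.mul_assoc]
  abel

lemma entrySmoothAt_fieldSLin {X : Type*} [NormedAddCommGroup X] [NormedSpace ℝ X] {x : X}
    {e : X → ℝ} {L₁ L₂ : X → Matrix (Fin n) (Fin n) ℝ}
    (he : ContDiffAt ℝ 1 e x) (h1 : EntrySmoothAt L₁ x)
    (h2 : EntrySmoothAt L₂ x) (hK : (p.KE (e x) (L₁ x) (L₂ x)).det ≠ 0) :
    EntrySmoothAt (fun y => p.fieldSLin (e y) (L₁ y) (L₂ y)) x :=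
  ((((entrySmoothAt_blendE he h1 h2).mul (entrySmoothAt_const _)).mul
    ((p.entrySmoothAt_KE he h1 h2).inv hK)).mul (entrySmoothAt_const _)).sub
    (entrySmoothAt_const _)

section CompanionSolution

lemma entrySmoothAt_state_fst (z : State n) :
    EntrySmoothAt (fun y : State n => Matrix.of y.2.1) z :=
  fun i j => by simp only [Matrix.of_apply]; fun_prop

lemma entrySmoothAt_state_snd (z : State n) :
    EntrySmoothAt (fun y : State n => Matrix.of y.2.2.1) z :=
  fun i j => by simp only [Matrix.of_apply]; fun_prop

lemma entrySmoothAt_state_thd (z : State n) :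
    EntrySmoothAt (fun y : State n => Matrix.of y.2.2.2.1) z :=
  fun i j => by simp only [Matrix.of_apply]; fun_prop

variable {T e : ℝ} {L₁ L₂ : ℝ → Matrix (Fin n) (Fin n) ℝ} {S : ℝ → Matrix (Fin n) (Fin 1) ℝ}

lemma of_mkState_fst (e : ℝ) (L₁ L₂ : Matrix (Fin n) (Fin n) ℝ) (S : Matrix (Fin n) (Fin 1) ℝ)
    (r : ℝ) : Matrix.of (mkState e L₁ L₂ S r).2.1 = L₁ := rfl

lemma of_mkState_snd (e : ℝ) (L₁ L₂ : Matrix (Fin n) (Fin n) ℝ) (S : Matrix (Fin n) (Fin 1) ℝ)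
    (r : ℝ) : Matrix.of (mkState e L₁ L₂ S r).2.2.1 = L₂ := rfl

lemma of_mkState_thd (e : ℝ) (L₁ L₂ : Matrix (Fin n) (Fin n) ℝ) (S : Matrix (Fin n) (Fin 1) ℝ)
    (r : ℝ) : Matrix.of (mkState e L₁ L₂ S r).2.2.2.1 = S := rfl

lemma mkState_fst (e : ℝ) (L₁ L₂ : Matrix (Fin n) (Fin n) ℝ) (S : Matrix (Fin n) (Fin 1) ℝ)
    (r : ℝ) : (mkState e L₁ L₂ S r).1 = e := rfl

lemma continuousOn_fieldSLin (h1 : ∀ i j, ContinuousOn (fun u => L₁ u i j) (Icc 0 T))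
    (h2 : ∀ i j, ContinuousOn (fun u => L₂ u i j) (Icc 0 T))
    (hK : ∀ t ∈ Icc 0 T, (p.KE e (L₁ t) (L₂ t)).det ≠ 0) (i j : Fin n) :
    ContinuousOn (fun t => p.fieldSLin e (L₁ t) (L₂ t) i j) (Icc 0 T) := by
  have hF : ∀ t ∈ Icc 0 T, ContDiffAt ℝ 1
      (fun y : State n => p.fieldSLin y.1 (Matrix.of y.2.1) (Matrix.of y.2.2.1) i j)
      (mkState e (L₁ t) (L₂ t) 0 0) := fun t ht => by
    refine p.entrySmoothAt_fieldSLin contDiffAt_fst (entrySmoothAt_state_fst _)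
      (entrySmoothAt_state_snd _) ?_ i j
    rw [of_mkState_fst, of_mkState_snd, mkState_fst]
    exact hK t ht
  have h := continuousOn_comp_mkState (S := fun _ => 0) h1 h2 (fun _ _ => continuousOn_const) hF
  simpa only [of_mkState_fst, of_mkState_snd, mkState_fst] using h

lemma continuousOn_fieldS (h1 : ∀ i j, ContinuousOn (fun u => L₁ u i j) (Icc 0 T))
    (h2 : ∀ i j, ContinuousOn (fun u => L₂ u i j) (Icc 0 T))
    (hS : ∀ i j, ContinuousOn (fun u => S u i j) (Icc 0 T))
    (hK : ∀ t ∈ Icc 0 T, (p.KE e (L₁ t) (L₂ t)).det ≠ 0) (i : Fin n) (j : Fin 1) :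
    ContinuousOn (fun t => p.fieldS e (L₁ t) (L₂ t) (S t) i j) (Icc 0 T) := by
  have hF : ∀ t ∈ Icc 0 T, ContDiffAt ℝ 1
      (fun y : State n => p.fieldS y.1 (Matrix.of y.2.1) (Matrix.of y.2.2.1) (Matrix.of y.2.2.2.1) i j)
      (mkState e (L₁ t) (L₂ t) (S t) 0) := fun t ht => by
    refine p.entrySmoothAt_fieldS contDiffAt_fst (entrySmoothAt_state_fst _)
      (entrySmoothAt_state_snd _) (entrySmoothAt_state_thd _) ?_ i j
    rw [of_mkState_fst, of_mkState_snd, mkState_fst]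
    exact hK t ht
  have h := continuousOn_comp_mkState h1 h2 hS hF
  simpa only [of_mkState_fst, of_mkState_snd, of_mkState_thd, mkState_fst] using h

lemma continuousOn_fieldr (h1 : ∀ i j, ContinuousOn (fun u => L₁ u i j) (Icc 0 T))
    (h2 : ∀ i j, ContinuousOn (fun u => L₂ u i j) (Icc 0 T))
    (hS : ∀ i j, ContinuousOn (fun u => S u i j) (Icc 0 T))
    (hK : ∀ t ∈ Icc 0 T, (p.KE e (L₁ t) (L₂ t)).det ≠ 0) (i j : Fin 1) :
    ContinuousOn (fun t => p.fieldr e (L₁ t) (L₂ t) (S t) i j) (Icc 0 T) := by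
  have hF : ∀ t ∈ Icc 0 T, ContDiffAt ℝ 1
      (fun y : State n => p.fieldr y.1 (Matrix.of y.2.1) (Matrix.of y.2.2.1) (Matrix.of y.2.2.2.1) i j)
      (mkState e (L₁ t) (L₂ t) (S t) 0) := fun t ht => by
    refine p.entrySmoothAt_fieldr contDiffAt_fst (entrySmoothAt_state_fst _)
      (entrySmoothAt_state_snd _) (entrySmoothAt_state_thd _) ?_ i j
    rw [of_mkState_fst, of_mkState_snd, mkState_fst]
    exact hK t ht
  have h := continuousOn_comp_mkState h1 h2 hS hF
  simpa only [of_mkState_fst, of_mkState_snd, of_mkState_thd, mkState_fst] using h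

/-- The companion equation for `S` is solvable on the whole interval along given continuous
`L₁`, `L₂`. -/
lemma exists_fieldS_solution (hT : 0 < T)
    (h1 : ∀ i j, ContinuousOn (fun u => L₁ u i j) (Icc 0 T))
    (h2 : ∀ i j, ContinuousOn (fun u => L₂ u i j) (Icc 0 T))
    (hK : ∀ t ∈ Icc 0 T, (p.KE e (L₁ t) (L₂ t)).det ≠ 0) :
    ∃ S : ℝ → Matrix (Fin n) (Fin 1) ℝ, S T = 0 ∧
      ∀ t ∈ Icc 0 T, ∀ i j, HasDerivWithinAt (fun u => S u i j)
        (p.fieldS e (L₁ t) (L₂ t) (S t) i j) (Icc 0 T) t := by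
  obtain ⟨x, hxT, hx⟩ := exists_linear_backward hT
    (M := fun t => p.fieldSLin e (L₁ t) (L₂ t)) (b := fun t i => p.fieldS e (L₁ t) (L₂ t) 0 i 0)
    (p.continuousOn_fieldSLin h1 h2 hK)
    (fun i => p.continuousOn_fieldS h1 h2 (fun _ _ => continuousOn_const) hK i 0)
  refine ⟨fun t => Matrix.of fun i _ => x t i, ?_, fun t ht i j => ?_⟩
  · ext i j
    simp [hxT]
  · have h := hasDerivWithinAt_pi.1 (hx t ht) i
    rw [fieldS_eq_lin_mul_add, Subsingleton.elim j 0]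
    exact h

/-- The companion equation for `r` is solvable on the whole interval along given continuous
`L₁`, `L₂`, `S`. -/
lemma exists_fieldr_solution (hT : 0 < T)
    (h1 : ∀ i j, ContinuousOn (fun u => L₁ u i j) (Icc 0 T))
    (h2 : ∀ i j, ContinuousOn (fun u => L₂ u i j) (Icc 0 T))
    (hS : ∀ i j, ContinuousOn (fun u => S u i j) (Icc 0 T))
    (hK : ∀ t ∈ Icc 0 T, (p.KE e (L₁ t) (L₂ t)).det ≠ 0) :
    ∃ r : ℝ → ℝ, r T = 0 ∧
      ∀ t ∈ Icc 0 T, HasDerivWithinAt r (p.fieldr e (L₁ t) (L₂ t) (S t) 0 0) (Icc 0 T) t := by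
  obtain ⟨y, hyT, hy⟩ := exists_linear_backward hT (m := 1) (M := fun _ => 0)
    (b := fun t _ => p.fieldr e (L₁ t) (L₂ t) (S t) 0 0) (fun _ _ => continuousOn_const)
    (fun _ => p.continuousOn_fieldr h1 h2 hS hK 0 0)
  refine ⟨fun t => y t 0, by simp [hyT], fun t ht => ?_⟩
  have h := hasDerivWithinAt_pi.1 (hy t ht) 0
  rwa [Matrix.zero_mulVec, zero_add] at h

end CompanionSolution

lemma abs_sub_le_norm_mkState_sub (e e' : ℝ) (L₁ L₂ L₁' L₂' : Matrix (Fin n) (Fin n) ℝ)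
    (S S' : Matrix (Fin n) (Fin 1) ℝ) (r r' : ℝ) :
    (∀ i j, |S i j - S' i j| ≤ ‖mkState e L₁ L₂ S r - mkState e' L₁' L₂' S' r'‖) ∧
      |r - r'| ≤ ‖mkState e L₁ L₂ S r - mkState e' L₁' L₂' S' r'‖ := by
  set w := mkState e L₁ L₂ S r - mkState e' L₁' L₂' S' r'
  have h : ‖w.2.2.2‖ ≤ ‖w‖ := (norm_snd_le w.2.2).trans ((norm_snd_le w.2).trans (norm_snd_le w))
  exact ⟨fun i j => (norm_le_pi_norm (w.2.2.2.1 i) j).trans <| (norm_le_pi_norm w.2.2.2.1 i).trans <|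
    (norm_fst_le w.2.2.2).trans h, (norm_snd_le w.2.2.2).trans h⟩

lemma frob_le_of_abs_le {M : Matrix (Fin n) (Fin 1) ℝ} {c : ℝ} (hc : 0 ≤ c)
    (h : ∀ i j, |M i j| ≤ c) : frob M ≤ n * c := by
  refine Real.sqrt_le_iff.2 ⟨by positivity, ?_⟩
  have h1 : ∑ i, ∑ j, (M i j) ^ 2 ≤ ∑ _i : Fin n, c ^ 2 :=
    Finset.sum_le_sum fun i _ => by
      simpa using (sq_abs (M i 0)).symm.le.trans (pow_le_pow_left₀ (abs_nonneg _) (h i 0) 2)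
  refine h1.trans ?_
  have h2 : (n : ℝ) ≤ (n : ℝ) ^ 2 := by exact_mod_cast Nat.le_self_pow two_ne_zero n
  rw [Finset.sum_const, Finset.card_univ, Fintype.card_fin, nsmul_eq_mul, mul_pow]
  exact mul_le_mul_of_nonneg_right h2 (sq_nonneg c)

lemma norm_terminal_sub_le :
    ‖mkState (1 / (N : ℝ)) (p.Qf + (1 / (N : ℝ)) • p.QfΓ) p.QfΓ 0 0 -
      mkState 0 p.Qf p.QfΓ 0 0‖ ≤ (1 + l1norm p.QfΓ) / (N : ℝ) := by
  have hl : ∀ i j, |p.QfΓ i j| ≤ l1norm p.QfΓ := fun i j =>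
    (Finset.single_le_sum (f := fun j => |p.QfΓ i j|) (fun _ _ => abs_nonneg _)
      (Finset.mem_univ j)).trans
    (Finset.single_le_sum (f := fun i => ∑ j, |p.QfΓ i j|)
      (fun _ _ => Finset.sum_nonneg fun _ _ => abs_nonneg _) (Finset.mem_univ i))
  have hl0 : 0 ≤ l1norm p.QfΓ := Finset.sum_nonneg fun _ _ => Finset.sum_nonneg fun _ _ =>
    abs_nonneg _
  have hb : 0 ≤ (1 + l1norm p.QfΓ) / (N : ℝ) := by positivity
  refine norm_prod_le_iff.2 ⟨?_, norm_prod_le_iff.2 ⟨?_, ?_⟩⟩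
  · simp only [mkState, Prod.fst_sub, sub_zero, Real.norm_eq_abs, abs_of_nonneg, one_div,
      inv_nonneg, Nat.cast_nonneg]
    rw [← one_div]
    gcongr
    linarith
  · refine (pi_norm_le_iff_of_nonneg hb).2 fun i => (pi_norm_le_iff_of_nonneg hb).2 fun j => ?_
    simp only [mkState, Prod.snd_sub, Prod.fst_sub, Pi.sub_apply, Matrix.add_apply,
      Matrix.smul_apply, smul_eq_mul, add_sub_cancel_left, Real.norm_eq_abs]
    rw [abs_mul, abs_of_nonneg (by positivity), one_div_mul_eq_div]
    gcongr
    linarith [hl i j]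
  · simpa [mkState] using hb

section RescaledSolution

variable {Λ₁ Λ₂ : ℝ → Matrix (Fin n) (Fin n) ℝ} {S : ℝ → Matrix (Fin n) (Fin 1) ℝ} {r : ℝ → ℝ}

lemma isSolSrN_iff :
    p.IsSolSrN N Λ₁ Λ₂ S r ↔ S p.T = 0 ∧ r p.T = 0 ∧
      (∀ t ∈ Icc 0 p.T, ∀ i j, HasDerivWithinAt (fun u => S u i j)
        (p.fieldS (1 / (N : ℝ)) (Λ₁ t) (Λ₂ t) (S t) i j) (Icc 0 p.T) t) ∧
      ∀ t ∈ Icc 0 p.T, HasDerivWithinAt r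
        (p.fieldr (1 / (N : ℝ)) (Λ₁ t) (Λ₂ t) (S t) 0 0) (Icc 0 p.T) t := by
  simp only [IsSolSrN, fieldS_inv_nat, fieldr_inv_nat]

lemma IsSolLamN.hasDerivWithinAt_mkState (hN : (N : ℝ) ≠ 0) (hΛ : p.IsSolLamN N Λ₁ Λ₂)
    (h : p.IsSolSrN N Λ₁ Λ₂ S r) :
    ∀ t ∈ Icc 0 p.T, HasDerivWithinAt (fun u => mkState (1 / (N : ℝ)) (Λ₁ u) (Λ₂ u) (S u) (r u))
      (p.jointField (mkState (1 / (N : ℝ)) (Λ₁ t) (Λ₂ t) (S t) (r t))) (Icc 0 p.T) t := by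
  obtain ⟨-, -, -, -, d1, d2⟩ := hΛ
  obtain ⟨-, -, dS, dr⟩ := p.isSolSrN_iff.1 h
  intro t ht
  refine p.hasDerivWithinAt_mkState (fun i j => ?_) (fun i j => ?_) (dS t ht) (dr t ht)
  · rw [field1_inv_nat p hN]; exact d1 t ht i j
  · rw [field2_inv_nat p hN]; exact d2 t ht i j

lemma IsSolLamN.exists_isSolSrN (hT : 0 < p.T) (hΛ : p.IsSolLamN N Λ₁ Λ₂) :
    ∃ (S : ℝ → Matrix (Fin n) (Fin 1) ℝ) (r : ℝ → ℝ), p.IsSolSrN N Λ₁ Λ₂ S r := by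
  obtain ⟨-, pos, -, -, d1, d2⟩ := hΛ
  have c1 : ∀ i j, ContinuousOn (fun u => Λ₁ u i j) (Icc 0 p.T) :=
    fun i j t ht => (d1 t ht i j).continuousWithinAt
  have c2 : ∀ i j, ContinuousOn (fun u => Λ₂ u i j) (Icc 0 p.T) :=
    fun i j t ht => (d2 t ht i j).continuousWithinAt
  have hK : ∀ t ∈ Icc 0 p.T, (p.KE (1 / (N : ℝ)) (Λ₁ t) (Λ₂ t)).det ≠ 0 :=
    fun t ht => (pos t ht).2.2.det_pos.ne'
  obtain ⟨S, hST, dS⟩ := p.exists_fieldS_solution hT c1 c2 hK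
  obtain ⟨r, hrT, dr⟩ := p.exists_fieldr_solution hT c1 c2
    (fun i j t ht => (dS t ht i j).continuousWithinAt) hK
  exact ⟨S, r, p.isSolSrN_iff.2 ⟨hST, hrT, dS, dr⟩⟩

lemma IsSolLamN.isSolSrN_unique (hN : (N : ℝ) ≠ 0) (hΛ : p.IsSolLamN N Λ₁ Λ₂)
    {S' : ℝ → Matrix (Fin n) (Fin 1) ℝ} {r' : ℝ → ℝ} (h : p.IsSolSrN N Λ₁ Λ₂ S r)
    (h' : p.IsSolSrN N Λ₁ Λ₂ S' r') : ∀ t ∈ Icc 0 p.T, S' t = S t ∧ r' t = r t := by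
  intro t ht
  have key := terminal_value_unique (IsSolLamN.hasDerivWithinAt_mkState p hN hΛ h)
    (fun t ht => p.contDiffAt_jointField _ _ _ _ _ (hΛ.2.1 t ht).1.det_pos.ne'
      (hΛ.2.1 t ht).2.1.det_pos.ne' (hΛ.2.1 t ht).2.2.det_pos.ne')
    (IsSolLamN.hasDerivWithinAt_mkState p hN hΛ h')
    (by simp only [h.1, h.2.1, h'.1, h'.2.1]) t ht
  simp only [mkState, Prod.mk.injEq] at key
  exact ⟨key.2.2.2.1, key.2.2.2.2⟩

lemma IsSolLamN.isSolS_stackN (hN : (N : ℝ) ≠ 0) (hΛ : p.IsSolLamN N Λ₁ Λ₂)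
    (h : p.IsSolSrN N Λ₁ Λ₂ S r) :
    p.IsSolS N (fun t => blockPN N n (Λ₁ t) (Λ₂ t)) (fun t => stackN N (S t)) := by
  obtain ⟨hST, -, dS, -⟩ := p.isSolSrN_iff.1 h
  refine ⟨by simp only [hST]; rfl, fun t ht x y => ?_⟩
  rw [stackedS_rhs p hN (hΛ.1 t ht).1 (hΛ.1 t ht).2 (hΛ.2.1 t ht).1.det_pos.ne'.isUnit
    (hΛ.2.1 t ht).2.2.det_pos.ne'.isUnit]
  exact dS t ht x.2 y

lemma IsSolLamN.isSolr_stackN (hN : (N : ℝ) ≠ 0) (hΛ : p.IsSolLamN N Λ₁ Λ₂)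
    (h : p.IsSolSrN N Λ₁ Λ₂ S r) :
    p.IsSolr N (fun t => blockPN N n (Λ₁ t) (Λ₂ t)) (fun t => stackN N (S t))
      (fun t => (N : ℝ) * r t) := by
  obtain ⟨-, hrT, -, dr⟩ := p.isSolSrN_iff.1 h
  refine ⟨by simp only [hrT, mul_zero], fun t ht => ?_⟩
  rw [stackedr_rhs p hN (hΛ.1 t ht).1 (hΛ.1 t ht).2 (hΛ.2.1 t ht).1.det_pos.ne'.isUnit
    (hΛ.2.1 t ht).2.2.det_pos.ne'.isUnit]
  exact (dr t ht).const_mul (N : ℝ)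

end RescaledSolution

lemma IsSolLim.hasDerivWithinAt_mkState {Λ₁ Λ₂ : ℝ → Matrix (Fin n) (Fin n) ℝ}
    {S : ℝ → Matrix (Fin n) (Fin 1) ℝ} {r : ℝ → ℝ} (hΛ : p.IsSolLim Λ₁ Λ₂)
    (h : p.IsSolSr Λ₁ Λ₂ S r) :
    ∀ t ∈ Icc 0 p.T, HasDerivWithinAt (fun u => mkState 0 (Λ₁ u) (Λ₂ u) (S u) (r u))
      (p.jointField (mkState 0 (Λ₁ t) (Λ₂ t) (S t) (r t))) (Icc 0 p.T) t := by
  obtain ⟨-, -, -, -, d1, d2⟩ := hΛ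
  obtain ⟨-, -, dS, dr⟩ := h
  intro t ht
  refine p.hasDerivWithinAt_mkState (fun i j => ?_) (fun i j => ?_) (fun i j => ?_) ?_
  · rw [field1_zero]; exact d1 t ht i j
  · rw [field2_zero]; exact d2 t ht i j
  · rw [fieldS_zero]; exact dS t ht i j
  · rw [fieldr_zero]; exact dr t ht

end Params

/-- solvability of the rescaled companion system (ODE-S^N r^N), the fact
that its stacked version solves (ODE-S) and (ODE-r), and the O(1/N) convergence to the
solution of the limiting companion system (ODE-Sr). -/
theorem solSrN_exists_unique_close {n n₁ : ℕ} (p : Params n n₁) (hp : p.Standing)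
    (Λ₁ Λ₂ : ℝ → Matrix (Fin n) (Fin n) ℝ)
    (S : ℝ → Matrix (Fin n) (Fin 1) ℝ) (r : ℝ → ℝ)
    (hLim : p.IsSolLim Λ₁ Λ₂) (hSr : p.IsSolSr Λ₁ Λ₂ S r) :
    ∃ N₁ : ℕ, 1 ≤ N₁ ∧ ∃ C : ℝ, 0 < C ∧
      ∀ N : ℕ, N₁ ≤ N →
        ∀ Λ₁N Λ₂N : ℝ → Matrix (Fin n) (Fin n) ℝ,
          p.IsSolLamN N Λ₁N Λ₂N →
          ∃ (SN : ℝ → Matrix (Fin n) (Fin 1) ℝ) (rN : ℝ → ℝ),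
            p.IsSolSrN N Λ₁N Λ₂N SN rN ∧
            (∀ (SN' : ℝ → Matrix (Fin n) (Fin 1) ℝ) (rN' : ℝ → ℝ),
              p.IsSolSrN N Λ₁N Λ₂N SN' rN' →
              ∀ t ∈ Icc (0 : ℝ) p.T, SN' t = SN t ∧ rN' t = rN t) ∧
            p.IsSolS N (fun t => blockPN N n (Λ₁N t) (Λ₂N t))
              (fun t => stackN N (SN t)) ∧
            p.IsSolr N (fun t => blockPN N n (Λ₁N t) (Λ₂N t))
              (fun t => stackN N (SN t)) (fun t => (N : ℝ) * rN t) ∧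
            (∀ t ∈ Icc (0 : ℝ) p.T,
              frob (SN t - S t) + |rN t - r t| ≤ C / (N : ℝ)) := by
  obtain ⟨C, δ, hC, hδ, hst⟩ := exists_stability_backward
    (Params.IsSolLim.hasDerivWithinAt_mkState p hLim hSr)
    (fun t ht => p.contDiffAt_jointField _ _ _ _ _ (hLim.2.1 t ht).1.det_pos.ne'
      (hLim.2.1 t ht).2.det_pos.ne' (by
        rw [Params.KE_zero]; exact (hLim.2.1 t ht).2.det_pos.ne'))
  have hq : 0 < 1 + l1norm p.QfΓ :=
    add_pos_of_pos_of_nonneg one_pos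
      (Finset.sum_nonneg fun _ _ => Finset.sum_nonneg fun _ _ => abs_nonneg _)
  obtain ⟨N₀, hN₀⟩ := exists_nat_gt ((1 + l1norm p.QfΓ) / δ)
  refine ⟨max N₀ 1, le_max_right _ _, (n + 1) * (C * (1 + l1norm p.QfΓ)), by positivity, ?_⟩
  intro N hN Λ₁N Λ₂N hΛ
  have hNpos : (0 : ℝ) < N := by exact_mod_cast (le_max_right N₀ 1).trans hN
  have hNδ : (1 + l1norm p.QfΓ) / (N : ℝ) < δ := by
    rw [div_lt_comm₀ hNpos hδ]
    exact hN₀.trans_le (by exact_mod_cast (le_max_left N₀ 1).trans hN)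
  obtain ⟨SN, rN, h⟩ := Params.IsSolLamN.exists_isSolSrN p hp.2.2.1 hΛ
  refine ⟨SN, rN, h, fun SN' rN' h' => Params.IsSolLamN.isSolSrN_unique p hNpos.ne' hΛ h h',
    Params.IsSolLamN.isSolS_stackN p hNpos.ne' hΛ h,
    Params.IsSolLamN.isSolr_stackN p hNpos.ne' hΛ h, fun t ht => ?_⟩
  have hclose := hst _ _ (Params.IsSolLamN.hasDerivWithinAt_mkState p hNpos.ne' hΛ h)
    (div_pos hq hNpos) hNδ (by
      simp only [h.1, h.2.1, hSr.1, hSr.2.1, hΛ.2.2.1, hΛ.2.2.2.1, hLim.2.2.1, hLim.2.2.2.1]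
      exact p.norm_terminal_sub_le) t ht
  obtain ⟨hS, hr⟩ := Params.abs_sub_le_norm_mkState_sub (1 / (N : ℝ)) 0 (Λ₁N t) (Λ₂N t) (Λ₁ t)
    (Λ₂ t) (SN t) (S t) (rN t) (r t)
  have hf := Params.frob_le_of_abs_le (M := SN t - S t)
    (by positivity : 0 ≤ C * ((1 + l1norm p.QfΓ) / (N : ℝ))) fun i j => (hS i j).trans hclose
  calc frob (SN t - S t) + |rN t - r t|
      ≤ n * (C * ((1 + l1norm p.QfΓ) / (N : ℝ))) + C * ((1 + l1norm p.QfΓ) / (N : ℝ)) :=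
        add_le_add hf (hr.trans hclose)
    _ = (n + 1) * (C * (1 + l1norm p.QfΓ)) / (N : ℝ) := by ring

end LQ
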